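/- arXiv:2505.07588 — 5 statements merged into one kernel-verified Lean document; each statement's English description precedes it below -/
import Mathlib

section
/- If H is a subgraph of G, then cat(H) ≤ cat(G). Moreover, for any vertex v of H, cat(H, v) ≤ cat(G, v). -/
open SimpleGraph

universe u

/-- The cat can move from `u` to `w` in `G`: there is a nontrivial path,
equivalently `w ≠ u` and `w` is reachable from `u`. -/
def CatMove {V : Type u} (G : SimpleGraph V) (u w : V) : Prop :=
  u ≠ w ∧ G.Reachable u w

/-- `CapturedIn G v n` : with the cat on `v` and the herder to cut next,
the herder can guarantee that the cat is isolated after at most `n` edge deletions. -/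
inductive CapturedIn {V : Type u} : SimpleGraph V → V → ℕ → Prop
  | isolated {G : SimpleGraph V} {v : V} {n : ℕ} (h : ∀ w, ¬ G.Adj v w) :
      CapturedIn G v n
  | cut {G : SimpleGraph V} {v : V} {n : ℕ} (e : Sym2 V) (he : e ∈ G.edgeSet)
      (h : ∀ w, CatMove (G.deleteEdges {e}) v w → CapturedIn (G.deleteEdges {e}) w n) :
      CapturedIn G v (n + 1)

/-- The cat number of `G` with the cat starting at `v` (the game value; `⊤` if
the herder cannot guarantee capture within any fixed number of cuts). -/
noncomputable def catVNum {V : Type u} (G : SimpleGraph V) (v : V) : ℕ∞ :=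
  sInf (Nat.cast '' {m : ℕ | CapturedIn G v m})

/-- The cat number of `G`: the cat picks the best starting vertex. -/
noncomputable def catNum {V : Type u} (G : SimpleGraph V) : ℕ∞ :=
  ⨆ v, catVNum G v

/-- The cat, starting at `v`, can evade capture forever: there is a set of safe
positions (remaining graph, cat location), closed under responding to any cut. -/
def CatWinFrom {V : Type u} (G : SimpleGraph V) (v : V) : Prop :=
  ∃ S : Set (SimpleGraph V × V), (G, v) ∈ S ∧
    ∀ p ∈ S, (∃ w, p.1.Adj p.2 w) ∧
      ∀ e ∈ p.1.edgeSet, ∃ w, CatMove (p.1.deleteEdges {e}) p.2 w ∧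
        (p.1.deleteEdges {e}, w) ∈ S

/-- `G` is cat-win if the cat can evade capture forever from some starting vertex. -/
def CatWin {V : Type u} (G : SimpleGraph V) : Prop :=
  ∃ v, CatWinFrom G v

/-- `Evades G v n` : the cat on `v` has a strategy giving a valid response to each
of the next `n` cuts. -/
inductive Evades {V : Type u} : SimpleGraph V → V → ℕ → Prop
  | zero {G : SimpleGraph V} {v : V} : Evades G v 0
  | succ {G : SimpleGraph V} {v : V} {n : ℕ} (move : Sym2 V → V)
      (hmove : ∀ e ∈ G.edgeSet, CatMove (G.deleteEdges {e}) v (move e))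
      (h : ∀ e ∈ G.edgeSet, Evades (G.deleteEdges {e}) (move e) n) :
      Evades G v (n + 1)

/-- `G` is `k`-evadible for every `k`: for each `n` the cat can respond to the
first `n` cuts from a suitable starting vertex. -/
def OmegaEvadible {V : Type u} (G : SimpleGraph V) : Prop :=
  ∀ n : ℕ, ∃ v, Evades G v n

/-- The infinite complete binary tree on binary strings. -/
def binTree : SimpleGraph (List Bool) :=
  SimpleGraph.fromRel (fun a b => ∃ t : Bool, b = a ++ [t])

/-- `H` is a minor of `G` : disjoint connected branch sets, one per vertex of `H`,
with an edge of `G` between branch sets for every edge of `H`. -/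
def IsMinor {W : Type*} {V : Type u} (H : SimpleGraph W) (G : SimpleGraph V) : Prop :=
  ∃ B : W → Set V,
    (∀ w, (G.induce (B w)).Connected) ∧
    (Pairwise fun w₁ w₂ => Disjoint (B w₁) (B w₂)) ∧
    (∀ w₁ w₂, H.Adj w₁ w₂ → ∃ x ∈ B w₁, ∃ y ∈ B w₂, G.Adj x y)

/-- Every pair of distinct vertices is joined by two edge-disjoint (finite) paths. -/
def TwoEdgeConnected {V : Type u} (G : SimpleGraph V) : Prop :=
  ∀ u v : V, u ≠ v → ∃ (p q : G.Walk u v), p.IsPath ∧ q.IsPath ∧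
    ∀ e ∈ p.edges, e ∉ q.edges

/-- `x` has degree exactly 1 in `G`. -/
def DegOne {V : Type u} (G : SimpleGraph V) (x : V) : Prop :=
  ∃ a, G.neighborSet x = {a}

/-- `x` has degree exactly 2 in `G`. -/
def DegTwo {V : Type u} (G : SimpleGraph V) (x : V) : Prop :=
  ∃ a b, a ≠ b ∧ G.neighborSet x = {a, b}

/-- `x` has degree exactly 3 in `G`. -/
def DegThree {V : Type u} (G : SimpleGraph V) (x : V) : Prop :=
  ∃ a b c, a ≠ b ∧ a ≠ c ∧ b ≠ c ∧ G.neighborSet x = {a, b, c}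

/-- `x` has degree at least `k` in `G`. -/
def DegGe {V : Type u} (G : SimpleGraph V) (x : V) (k : ℕ) : Prop :=
  ∃ s : Finset V, s.card = k ∧ ∀ a ∈ s, G.Adj x a

theorem CapturedIn.mono_graph {V : Type u} {G : SimpleGraph V} {v : V} {n : ℕ}
    (hG : CapturedIn G v n) : ∀ H : SimpleGraph V, H ≤ G → CapturedIn H v n := by
  induction hG with
  | isolated h => exact fun H hH => CapturedIn.isolated fun w hw => h w (hH hw)
  | @cut G v n e he h ih =>
    intro H hH
    have key : ∀ f ∈ H.edgeSet, H.deleteEdges {f} ≤ G.deleteEdges {e} →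
        CapturedIn H v (n + 1) := fun f hf hle =>
      CapturedIn.cut f hf fun w hw => ih w ⟨hw.1, hw.2.mono hle⟩ _ hle
    by_cases heH : e ∈ H.edgeSet
    · refine key e heH ?_
      intro a b hab
      rw [SimpleGraph.deleteEdges_adj] at hab ⊢
      exact ⟨hH hab.1, hab.2⟩
    · by_cases hv : ∃ w, H.Adj v w
      · obtain ⟨w, hw⟩ := hv
        refine key s(v, w) hw ?_
        intro a b hab
        rw [SimpleGraph.deleteEdges_adj] at hab ⊢
        refine ⟨hH hab.1, fun hmem => heH ?_⟩
        rw [Set.mem_singleton_iff] at hmem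
        rw [← hmem]
        exact hab.1
      · exact CapturedIn.isolated fun w hw => hv ⟨w, hw⟩

/-- If `H` is a subgraph of `G`, then `cat(H) ≤ cat(G)`, and
`cat(H, v) ≤ cat(G, v)` for every vertex `v` of `H`. -/
theorem subgraph_catNum_le {V : Type u} (G H : SimpleGraph V) (hsub : H ≤ G) :
    catNum H ≤ catNum G ∧ ∀ v : V, catVNum H v ≤ catVNum G v := by
  have hv : ∀ v : V, catVNum H v ≤ catVNum G v := fun v =>
    sInf_le_sInf (Set.image_mono fun m hm => CapturedIn.mono_graph hm H hsub)
  exact ⟨iSup_mono hv, hv⟩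
end

section
/- For n ≥ 2, the star K_{1,n-1} has cat number exactly 2 when n ≥ 3, while cat(K_1) = 0 and cat(K_2) = 1. -/
open SimpleGraph

universe u

theorem catVNum_le_of {V : Type u} {G : SimpleGraph V} {v : V} {m : ℕ}
    (h : CapturedIn G v m) : catVNum G v ≤ (m : ℕ∞) :=
  sInf_le ⟨m, h, rfl⟩

theorem le_catVNum_of {V : Type u} {G : SimpleGraph V} {v : V} {k : ℕ}
    (h : ∀ m, CapturedIn G v m → k ≤ m) : (k : ℕ∞) ≤ catVNum G v := by
  apply le_sInf
  rintro _ ⟨m, hm, rfl⟩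
  exact Nat.cast_le.mpr (h m hm)

theorem not_reach_of_isolated {V : Type u} {G : SimpleGraph V} {v w : V}
    (h : ∀ x, ¬ G.Adj v x) (hm : CatMove G v w) : False := by
  obtain ⟨hne, ⟨p⟩⟩ := hm
  cases p with
  | nil => exact hne rfl
  | cons hadj _ => exact h _ hadj

theorem captured_one {V : Type u} {G : SimpleGraph V} {v a : V}
    (h : ∀ w, G.Adj v w → w = a) : CapturedIn G v 1 := by
  by_cases ha : G.Adj v a
  · refine CapturedIn.cut (n := 0) s(v, a) ha ?_
    intro w hw
    refine (not_reach_of_isolated ?_ hw).elim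
    intro x hx
    rw [SimpleGraph.deleteEdges_adj] at hx
    have := h x hx.1
    subst this
    exact hx.2 rfl
  · refine CapturedIn.isolated ?_
    intro w hw
    have := h w hw
    subst this
    exact ha hw

theorem one_le_of_adj {V : Type u} {G : SimpleGraph V} {v a : V} (h : G.Adj v a)
    (m : ℕ) (hm : CapturedIn G v m) : 1 ≤ m := by
  cases hm with
  | isolated hi => exact (hi a h).elim
  | cut e he hh => omega

theorem two_le_of_adj {V : Type u} {G : SimpleGraph V} {v a b : V} (h : G.Adj v a)
    (h2 : G.Adj v b) (hab : a ≠ b) (m : ℕ) (hm : CapturedIn G v m) : 2 ≤ m := by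
  cases hm with
  | isolated hi => exact (hi a h).elim
  | @cut _ _ n e he hh =>
    have key : ∃ c, (G.deleteEdges {e}).Adj v c := by
      by_cases hea : e = s(v, a)
      · refine ⟨b, ?_⟩
        rw [SimpleGraph.deleteEdges_adj]
        refine ⟨h2, ?_⟩
        intro hc
        rw [Set.mem_singleton_iff, hea, Sym2.congr_right] at hc
        exact hab hc.symm
      · refine ⟨a, ?_⟩
        rw [SimpleGraph.deleteEdges_adj]
        exact ⟨h, fun hc => hea hc.symm⟩
    obtain ⟨c, hc⟩ := key
    have := one_le_of_adj hc.symm n (hh c ⟨hc.ne, hc.reachable⟩)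
    omega

/-- For `n ≥ 3` the star `K_{1,n-1}` has cat number 2, while
`cat(K_1) = 0` and `cat(K_2) = 1`. -/
theorem catNum_star :
    (∀ n : ℕ, 3 ≤ n →
      catNum (completeBipartiteGraph (Fin 1) (Fin (n - 1))) = 2) ∧
    catNum (⊥ : SimpleGraph (Fin 1)) = 0 ∧
    catNum (⊤ : SimpleGraph (Fin 2)) = 1 := by
  refine ⟨?_, ?_, ?_⟩
  · intro n hn
    apply le_antisymm
    · refine iSup_le fun v => ?_
      refine catVNum_le_of (m := 2) ?_
      have leaf : ∀ (G : SimpleGraph (Fin 1 ⊕ Fin (n - 1))) (j : Fin (n - 1)),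
          G ≤ completeBipartiteGraph (Fin 1) (Fin (n - 1)) → CapturedIn G (Sum.inr j) 1 := by
        intro G j hG
        refine captured_one (a := Sum.inl 0) ?_
        rintro (w | w) hw
        · rw [Subsingleton.elim w 0]
        · have := hG hw
          simp at this
      rcases v with i | j
      · refine CapturedIn.cut (n := 1) s(Sum.inl i, Sum.inr ⟨0, by omega⟩) (by simp) ?_
        rintro (w | w) hw
        · exact (hw.1 (by rw [Subsingleton.elim w i])).elim
        · exact leaf _ _ (SimpleGraph.deleteEdges_le _)
      · refine CapturedIn.cut (n := 1) s(Sum.inl 0, Sum.inr j) (by simp) ?_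
        intro w hw
        refine (not_reach_of_isolated ?_ hw).elim
        rintro (x | x) hx
        · rw [SimpleGraph.deleteEdges_adj] at hx
          apply hx.2
          rw [Subsingleton.elim x 0, Sym2.eq_swap]
          rfl
        · rw [SimpleGraph.deleteEdges_adj] at hx
          simp at hx
    · refine le_trans ?_ (le_iSup _ (Sum.inl 0))
      refine le_catVNum_of (k := 2) ?_
      exact two_le_of_adj (a := Sum.inr ⟨0, by omega⟩) (b := Sum.inr ⟨1, by omega⟩)
        (by simp) (by simp) (by simp)
  · apply le_antisymm
    · refine iSup_le fun v => ?_
      exact catVNum_le_of (m := 0) (CapturedIn.isolated (by simp))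
    · exact bot_le
  · apply le_antisymm
    · refine iSup_le fun v => ?_
      refine catVNum_le_of (m := 1) (captured_one (a := 1 - v) ?_)
      revert v
      simp only [SimpleGraph.top_adj]
      decide
    · refine le_trans ?_ (le_iSup _ 0)
      exact le_catVNum_of (k := 1) (one_le_of_adj (a := 1) (by simp))
end

section
/- A tree T (possibly infinite) is cat-win if and only if T contains the infinite complete binary tree B^ω as a minor. -/
open SimpleGraph

universe u

namespace CatHerd

variable {V : Type u}

/-! ### Generalities on the winning predicate -/

lemma win_adj {G : SimpleGraph V} {v : V} (h : CatWinFrom G v) : ∃ w, G.Adj v w := by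
  obtain ⟨S, hS, h⟩ := h
  exact (h _ hS).1

lemma win_step {G : SimpleGraph V} {v : V} (h : CatWinFrom G v) {e : Sym2 V}
    (he : e ∈ G.edgeSet) :
    ∃ w, CatMove (G.deleteEdges {e}) v w ∧ CatWinFrom (G.deleteEdges {e}) w := by
  obtain ⟨S, hS, h⟩ := h
  obtain ⟨w, hw, hwS⟩ := (h _ hS).2 e he
  exact ⟨w, hw, S, hwS, h⟩

lemma reach_transfer {G H : SimpleGraph V} {K : Set V}
    (hK : ∀ a ∈ K, ∀ b, G.Adj a b → b ∈ K ∧ H.Adj a b) {v w : V} (hv : v ∈ K)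
    (h : G.Reachable v w) : w ∈ K ∧ H.Reachable v w := by
  obtain ⟨p⟩ := h
  induction p with
  | nil => exact ⟨hv, Reachable.refl _⟩
  | cons hadj p ih =>
    obtain ⟨h1, h2⟩ := hK _ hv _ hadj
    obtain ⟨h3, h4⟩ := ih h1
    exact ⟨h3, h2.reachable.trans h4⟩

lemma win_sim {G H : SimpleGraph V} {K : Set V} {v : V} (h : CatWinFrom G v) (hv : v ∈ K)
    (hK : ∀ a ∈ K, ∀ b, G.Adj a b → b ∈ K ∧ H.Adj a b) : CatWinFrom H v := by
  refine ⟨{p | ∃ G : SimpleGraph V, CatWinFrom G p.2 ∧ p.2 ∈ K ∧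
    ∀ a ∈ K, ∀ b, G.Adj a b → b ∈ K ∧ p.1.Adj a b}, ⟨G, h, hv, hK⟩, ?_⟩
  rintro ⟨H, v⟩ ⟨G, h, hv, hK⟩
  dsimp only at h hv hK ⊢
  obtain ⟨u, hu⟩ := win_adj h
  refine ⟨⟨u, (hK _ hv _ hu).2⟩, ?_⟩
  intro e he
  have key : ∃ e' ∈ G.edgeSet, ∀ a b, (G.deleteEdges {e'}).Adj a b → s(a, b) ≠ e := by
    by_cases heG : e ∈ G.edgeSet
    · refine ⟨e, heG, fun a b hab => ?_⟩
      rw [deleteEdges_adj] at hab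
      simpa using hab.2
    · refine ⟨s(v, u), hu, fun a b hab hh => heG ?_⟩
      rw [deleteEdges_adj] at hab
      rw [← hh]
      exact hab.1
  obtain ⟨e', he', hne⟩ := key
  obtain ⟨w, ⟨hvw, hreach⟩, hw⟩ := win_step h he'
  have hK' : ∀ a ∈ K, ∀ b, (G.deleteEdges {e'}).Adj a b →
      b ∈ K ∧ (H.deleteEdges {e}).Adj a b := by
    intro a ha b hab
    have h1 := hne a b hab
    rw [deleteEdges_adj] at hab
    obtain ⟨h2, h3⟩ := hK a ha b hab.1
    refine ⟨h2, ?_⟩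
    rw [deleteEdges_adj]
    exact ⟨h3, by simpa using h1⟩
  obtain ⟨h1, h2⟩ := reach_transfer hK' hv hreach
  exact ⟨w, ⟨hvw, h2⟩, _, hw, h1, hK'⟩

lemma win_mono {G H : SimpleGraph V} {v : V} (h : CatWinFrom G v) (hGH : G ≤ H) :
    CatWinFrom H v :=
  win_sim (K := Set.univ) h trivial (fun _ _ _ hab => ⟨trivial, hGH hab⟩)

/-! ### Restricting to vertex sets -/

def res (T : SimpleGraph V) (C : Set V) : SimpleGraph V where
  Adj a b := T.Adj a b ∧ a ∈ C ∧ b ∈ C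
  symm := ⟨fun _ _ h => ⟨h.1.symm, h.2.2, h.2.1⟩⟩
  loopless := ⟨fun _ h => h.1.ne rfl⟩

lemma res_adj {T : SimpleGraph V} {C : Set V} {a b : V} :
    (res T C).Adj a b ↔ T.Adj a b ∧ a ∈ C ∧ b ∈ C := Iff.rfl

lemma res_mono {T : SimpleGraph V} {C D : Set V} (h : C ⊆ D) : res T C ≤ res T D :=
  fun _ _ hab => ⟨hab.1, h hab.2.1, h hab.2.2⟩

lemma res_reach_mem {T : SimpleGraph V} {C : Set V} {a b : V} (ha : a ∈ C)
    (h : (res T C).Reachable a b) : b ∈ C :=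
  (reach_transfer (G := res T C) (H := res T C) (K := C) (fun _ _ _ hab => ⟨hab.2.2, hab⟩) ha h).1

def Conn (T : SimpleGraph V) (C : Set V) : Prop :=
  ∀ a ∈ C, ∀ b ∈ C, (res T C).Reachable a b

lemma Conn.induce {T : SimpleGraph V} {C : Set V} (h : Conn T C) {y : V} (hy : y ∈ C) :
    (T.induce C).Connected := by
  have key : ∀ a b, (res T C).Reachable a b → ∀ (ha : a ∈ C) (hb : b ∈ C),
      (T.induce C).Reachable ⟨a, ha⟩ ⟨b, hb⟩ := by
    rintro a b ⟨p⟩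
    induction p with
    | nil => intro _ _; exact Reachable.refl _
    | cons hadj p ih =>
      intro ha hb
      have : (T.induce C).Adj ⟨_, ha⟩ ⟨_, hadj.2.2⟩ := hadj.1
      exact this.reachable.trans (ih _ _)
  have : Nonempty C := ⟨⟨y, hy⟩⟩
  exact ⟨fun a b => key a b (h a a.2 b b.2) a.2 b.2⟩

def Q (T : SimpleGraph V) (C : Set V) (y : V) : Prop :=
  y ∈ C ∧ Conn T C ∧ ∃ w ∈ C, CatWinFrom (res T C) w

/-- A connected set from `y` meeting `X` in exactly one point. -/
lemma exists_first {T : SimpleGraph V} {C X : Set V} {y w : V} (hy : y ∈ C)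
    (h : (res T C).Reachable y w) (hw : w ∈ X) :
    ∃ P ⊆ C, y ∈ P ∧ Conn T P ∧ ∃ x ∈ P, x ∈ X ∧ ∀ z ∈ P, z ∈ X → z = x := by
  obtain ⟨p⟩ := h
  have single : ∀ y ∈ C, y ∈ X → 
      ∃ P ⊆ C, y ∈ P ∧ Conn T P ∧ ∃ x ∈ P, x ∈ X ∧ ∀ z ∈ P, z ∈ X → z = x := by
    intro y hy hyX
    refine ⟨{y}, by simpa using hy, rfl, ?_, y, rfl, hyX, fun z hz _ => hz⟩
    rintro a rfl b rfl
    exact Reachable.refl _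
  induction p with
  | nil => exact single _ hy hw
  | @cons u v w hadj p ih =>
    by_cases hu : u ∈ X
    · exact single _ hy hu
    obtain ⟨P, hPC, hvP, hP, x, hxP, hxX, hx⟩ := ih hadj.2.2 hw
    refine ⟨insert u P, Set.insert_subset hy hPC, Set.mem_insert _ _, ?_, x,
      Set.mem_insert_of_mem _ hxP, hxX, ?_⟩
    · have h1 : ∀ a ∈ insert u P, (res T (insert u P)).Reachable a v := by
        rintro a (rfl | ha)
        · exact Adj.reachable ⟨hadj.1, Set.mem_insert _ _, Set.mem_insert_of_mem _ hvP⟩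
        · exact (hP a ha v hvP).mono (res_mono (Set.subset_insert _ _))
      exact fun a ha b hb => (h1 a ha).trans (h1 b hb).symm
    · rintro z (rfl | hz) hzX
      · exact absurd hzX hu
      · exact hx z hz hzX

/-- Component of `w` in `C \ P`. -/
def comp (T : SimpleGraph V) (C P : Set V) (w : V) : Set V :=
  {u | (res T (C \ P)).Reachable w u}

lemma split {T : SimpleGraph V} (ht : T.IsAcyclic) {C P : Set V} {w y : V}
    (hC : Conn T C) (hPC : P ⊆ C) (hP : Conn T P) (hy : y ∈ P) (hw : w ∈ C \ P)
    (hwin : CatWinFrom (res T C) w) :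
    ∃ c ∈ comp T C P w, ∃ p ∈ P, T.Adj p c ∧ Q T (comp T C P w) c ∧
      ∀ u ∈ comp T C P w, ∀ z ∈ P, ¬ ((res T C).deleteEdges {s(p, c)}).Reachable z u := by
  set D := comp T C P w with hD
  have hwD : w ∈ D := Reachable.refl _
  have hDC : D ⊆ C \ P := fun u hu => res_reach_mem hw hu
  have hbd : ∀ a ∈ D, ∀ b, (res T C).Adj a b → b ∉ D → b ∈ P := by
    intro a ha b hab hb
    by_contra hbP
    exact hb (Reachable.trans (show (res T (C \ P)).Reachable w a from ha)
      (Adj.reachable ⟨hab.1, hDC ha, hab.2.2, hbP⟩))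
  have hconnD : Conn T D := by
    have h1 : ∀ a ∈ D, (res T D).Reachable w a := by
      intro a ha
      refine (reach_transfer (G := res T (C \ P)) (K := D) ?_ hwD ha).2
      intro a ha b hab
      have hb : b ∈ D := Reachable.trans (show (res T (C \ P)).Reachable w a from ha) hab.reachable
      exact ⟨hb, hab.1, ha, hb⟩
    exact fun a ha b hb => (h1 a ha).symm.trans (h1 b hb)
  obtain ⟨q⟩ := hC w hw.1 y (hPC hy)
  obtain ⟨d, -, hd1, hd2⟩ := q.exists_boundary_dart D hwD (fun h => (hDC h).2 hy)
  have hd3 := hbd _ hd1 _ d.adj hd2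
  have hadj := d.adj
  generalize d.fst = c at *
  generalize d.snd = p at *
  have hno : ∀ u ∈ D, ∀ z ∈ P, ¬ ((res T C).deleteEdges {s(p, c)}).Reachable z u := by
    intro u hu z hz hr
    have hb := isAcyclic_iff_forall_adj_isBridge.1 ht hadj.1.symm
    rw [isBridge_iff] at hb
    apply hb
    have r1 : (T.deleteEdges {s(p, c)}).Reachable p z := by
      refine (hP p hd3 z hz).mono ?_
      intro a b hab
      rw [deleteEdges_adj]
      refine ⟨hab.1, fun h => ?_⟩
      have : c ∈ s(a, b) := by rw [Set.mem_singleton_iff.1 h]; simp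
      rcases Sym2.mem_iff.1 this with rfl | rfl
      · exact (hDC hd1).2 hab.2.1
      · exact (hDC hd1).2 hab.2.2
    have r2 : (T.deleteEdges {s(p, c)}).Reachable z u :=
      hr.mono (deleteEdges_mono (show res T C ≤ T from fun _ _ h => h.1))
    have r3 : (T.deleteEdges {s(p, c)}).Reachable u c := by
      refine (hconnD u hu c hd1).mono ?_
      intro a b hab
      rw [deleteEdges_adj]
      refine ⟨hab.1, fun h => ?_⟩
      have : p ∈ s(a, b) := by rw [Set.mem_singleton_iff.1 h]; simp
      rcases Sym2.mem_iff.1 this with rfl | rfl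
      · exact hd2 hab.2.1
      · exact hd2 hab.2.2
    exact (r1.trans r2).trans r3
  refine ⟨c, hd1, p, hd3, hadj.1.symm, ⟨hd1, hconnD, ?_⟩, hno⟩
  obtain ⟨w', ⟨-, hr⟩, hw'⟩ := win_step hwin (e := s(p, c)) hadj.symm
  have hcl : ∀ a ∈ D, ∀ b, ((res T C).deleteEdges {s(p, c)}).Adj a b →
      b ∈ D ∧ (res T D).Adj a b := by
    intro a ha b hab
    have hab' := hab
    rw [deleteEdges_adj] at hab'
    have hb : b ∈ D := by
      by_contra hb
      exact hno a ha b (hbd a ha b hab'.1 hb) hab.symm.reachable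
    exact ⟨hb, hab'.1.1, ha, hb⟩
  have hw'D := (reach_transfer hcl hwD hr).1
  exact ⟨w', hw'D, win_sim hw' hw'D hcl⟩

lemma Q_step {T : SimpleGraph V} (ht : T.IsAcyclic) {C : Set V} {y : V} (hQ : Q T C y) :
    ∃ P : Set V, P ⊆ C ∧ y ∈ P ∧ Conn T P ∧ ∃ (D : Bool → Set V) (c : Bool → V),
      (∀ t, D t ⊆ C \ P) ∧ Disjoint (D true) (D false) ∧ (∀ t, Q T (D t) (c t)) ∧
      ∀ t, ∃ p ∈ P, T.Adj p (c t) := by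
  obtain ⟨hy, hC, w₀, hw₀, hwin₀⟩ := hQ
  obtain ⟨P, hPC, hyP, hP, x, hxP, hxX, hx⟩ :=
    exists_first (X := {w | CatWinFrom (res T C) w}) hy (hC y hy w₀ hw₀) hwin₀
  have hxX : CatWinFrom (res T C) x := hxX
  have hnext : ∀ e ∈ (res T C).edgeSet, ∃ w ∈ C \ P, CatWinFrom (res T C) w ∧
      ((res T C).deleteEdges {e}).Reachable x w := by
    intro e he
    obtain ⟨w, ⟨hne, hr⟩, hw⟩ := win_step hxX he
    have hw2 : CatWinFrom (res T C) w := win_mono hw (deleteEdges_le _)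
    exact ⟨w, ⟨res_reach_mem (hPC hxP) (hr.mono (deleteEdges_le _)),
      fun hwP => hne (hx w hwP hw2).symm⟩, hw2, hr⟩
  obtain ⟨u, hu⟩ := win_adj hxX
  obtain ⟨w₁, hw₁, hwin₁, -⟩ := hnext s(x, u) hu
  obtain ⟨c₁, hc₁, p₁, hp₁, hadj₁, hQ₁, hno₁⟩ := split ht hC hPC hP hyP hw₁ hwin₁
  have hsub : ∀ w ∈ C \ P, comp T C P w ⊆ C \ P := fun w hw u hu => res_reach_mem hw hu
  obtain ⟨w₂, hw₂, hwin₂, hr₂⟩ := hnext s(p₁, c₁) ⟨hadj₁, hPC hp₁, (hsub _ hw₁ hc₁).1⟩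
  obtain ⟨c₂, hc₂, p₂, hp₂, hadj₂, hQ₂, -⟩ := split ht hC hPC hP hyP hw₂ hwin₂
  refine ⟨P, hPC, hyP, hP, fun t => if t then comp T C P w₁ else comp T C P w₂,
    fun t => if t then c₁ else c₂, ?_, ?_, ?_, ?_⟩
  · rintro (_ | _)
    · simpa using hsub _ hw₂
    · simpa using hsub _ hw₁
  · simp only [if_true, Bool.false_eq_true, if_false]
    rw [Set.disjoint_left]
    intro z hz1 hz2
    refine hno₁ w₂ ?_ x hxP hr₂
    exact Reachable.trans (show (res T (C \ P)).Reachable w₁ z from hz1) (Reachable.symm hz2)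
  · rintro (_ | _)
    · simpa using hQ₂
    · simpa using hQ₁
  · rintro (_ | _)
    · exact ⟨p₂, hp₂, by simpa using hadj₂⟩
    · exact ⟨p₁, hp₁, by simpa using hadj₁⟩

theorem forward {T : SimpleGraph V} (ht : T.IsTree) (h : CatWin T) : IsMinor binTree T := by
  obtain ⟨v, hv⟩ := h
  let St := {q : Set V × V // Q T q.1 q.2}
  have step : ∀ q : St, ∃ (P : Set V) (n : Bool → St), P ⊆ q.1.1 ∧ q.1.2 ∈ P ∧ Conn T P ∧
      (∀ t, (n t).1.1 ⊆ q.1.1 \ P) ∧ Disjoint (n true).1.1 (n false).1.1 ∧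
      ∀ t, ∃ p ∈ P, T.Adj p (n t).1.2 := by
    rintro ⟨⟨C, y⟩, hQ⟩
    obtain ⟨P, h1, h2, h3, D, c, h4, h5, h6, h7⟩ := Q_step ht.isAcyclic hQ
    exact ⟨P, fun t => ⟨(D t, c t), h6 t⟩, h1, h2, h3, h4, h5, h7⟩
  choose P n hPC hyP hP hn hdis hadj using step
  let B : List Bool → St → Set V := fun s => List.rec (fun q => P q) (fun t _ ih q => ih (n q t)) s
  have B0 : ∀ q, B [] q = P q := fun _ => rfl
  have B1 : ∀ t s q, B (t :: s) q = B s (n q t) := fun _ _ _ => rfl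
  have hBC : ∀ s q, B s q ⊆ q.1.1 := by
    intro s
    induction s with
    | nil => exact hPC
    | cons t s ih => 
      intro q
      rw [B1]
      exact (ih _).trans ((hn q t).trans Set.sdiff_subset)
  have hBP : ∀ t s q, Disjoint (B [] q) (B (t :: s) q) := by
    intro t s q
    rw [B0, B1, Set.disjoint_left]
    exact fun z hz hz' => (hn q t (hBC _ _ hz')).2 hz
  have hBconn : ∀ s q, (T.induce (B s q)).Connected := by
    intro s
    induction s with
    | nil => exact fun q => (hP q).induce (hyP q)
    | cons t s ih => exact fun q => ih _
  have hBdis : ∀ s s', s ≠ s' → ∀ q, Disjoint (B s q) (B s' q) := by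
    intro s
    induction s with
    | nil =>
      rintro (_ | ⟨t, s'⟩) hne q
      · exact absurd rfl hne
      · exact hBP _ _ _
    | cons t s ih =>
      rintro (_ | ⟨t', s'⟩) hne q
      · exact (hBP _ _ _).symm
      · by_cases htt : t = t'
        · subst htt
          exact ih s' (fun h => hne (by rw [h])) _
        · rw [B1, B1]
          refine Disjoint.mono (hBC _ _) (hBC _ _) ?_
          cases t <;> cases t'
          · exact absurd rfl htt
          · exact (hdis q).symm
          · exact hdis q
          · exact absurd rfl htt
  have hBadj : ∀ s t q, ∃ x ∈ B s q, ∃ y ∈ B (s ++ [t]) q, T.Adj x y := by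
    intro s t
    induction s with
    | nil =>
      intro q
      obtain ⟨p, hp, h⟩ := hadj q t
      exact ⟨p, hp, _, hyP _, h⟩
    | cons t' s ih => exact fun q => ih _
  have hQ0 : Q T Set.univ v := by
    have : res T Set.univ = T := by ext; simp [res_adj]
    refine ⟨trivial, ?_, v, trivial, ?_⟩
    · intro a _ b _
      rw [this]
      exact ht.connected.preconnected a b
    · rwa [this]
  let q0 : St := ⟨(Set.univ, v), hQ0⟩
  refine ⟨fun s => B s q0, fun s => hBconn s q0, fun s s' h => hBdis s s' h q0, ?_⟩
  intro s s' h
  rw [binTree, fromRel_adj] at h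
  obtain ⟨-, ⟨t, rfl⟩ | ⟨t, rfl⟩⟩ := h
  · exact hBadj s t q0
  · obtain ⟨x, hx, y, hy, hxy⟩ := hBadj s' t q0
    exact ⟨y, hy, x, hx, hxy.symm⟩

/-! ### From a minor to a cat strategy -/

structure Model (H : SimpleGraph V) (B : List Bool → Set V) : Prop where
  conn : ∀ s, (H.induce (B s)).Connected
  dis : ∀ s s', s ≠ s' → Disjoint (B s) (B s')
  adj : ∀ s t, ∃ x ∈ B s, ∃ y ∈ B (s ++ [t]), H.Adj x y

lemma Model.reach {H : SimpleGraph V} {B : List Bool → Set V} (h : Model H B) {s : List Bool}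
    {a b : V} (ha : a ∈ B s) (hb : b ∈ B s) : H.Reachable a b :=
  ((h.conn s).preconnected ⟨a, ha⟩ ⟨b, hb⟩).map (Embedding.induce (G := H) (B s)).toHom

lemma Model.sub {H H' : SimpleGraph V} {B : List Bool → Set V} (h : Model H B) (t : Bool)
    (hH : ∀ a b s, a ∈ B (t :: s) → b ∈ ⋃ s, B (t :: s) → H.Adj a b → H'.Adj a b) :
    Model H' (fun s => B (t :: s)) := by
  refine ⟨fun s => ?_, fun s s' hne => h.dis _ _ (by simpa using hne), fun s t' => ?_⟩
  · refine (h.conn (t :: s)).mono ?_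
    intro a b hab
    exact hH a b s a.2 (Set.mem_iUnion.2 ⟨s, b.2⟩) hab
  · obtain ⟨x, hx, y, hy, hxy⟩ := h.adj (t :: s) t'
    exact ⟨x, hx, y, hy, hH x y s hx (Set.mem_iUnion.2 ⟨s ++ [t'], hy⟩) hxy⟩

def Arm (H : SimpleGraph V) (v : V) : Prop :=
  ∃ B, Model H B ∧ ∃ a ∈ B [], H.Reachable v a

def Inv (G : SimpleGraph V) (v : V) : Prop :=
  ∃ H H' : SimpleGraph V, H ≤ G ∧ H' ≤ G ∧ (∀ a b, H.Adj a b → ¬ H'.Adj a b) ∧ Arm H v ∧ Arm H' v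

lemma Inv.mono {G G' : SimpleGraph V} {v : V} (h : Inv G v) (hG : G ≤ G') : Inv G' v := by
  obtain ⟨H, H', h1, h2, h3⟩ := h
  exact ⟨H, H', h1.trans hG, h2.trans hG, h3⟩

lemma Model.exists_inv {H : SimpleGraph V} {B : List Bool → Set V} (h : Model H B) :
    ∃ w ∈ B [], Inv H w := by
  obtain ⟨a, ha, a', ha', haa⟩ := h.adj [] false
  obtain ⟨b, hb, b', hb', hbb⟩ := h.adj [] true
  let U : Set V := ⋃ s, B (true :: s)
  have hU : ∀ x s, x ∈ B s → (∀ s', s ≠ true :: s') → x ∉ U := by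
    intro x s hx hs hxU
    obtain ⟨s', hs'⟩ := Set.mem_iUnion.1 hxU
    exact Set.disjoint_left.1 (h.dis _ _ (hs s')) hx hs'
  let H1 : SimpleGraph V := 
    { Adj := fun x y => H.Adj x y ∧ x ∉ U ∧ y ∉ U
      symm := ⟨fun _ _ h => ⟨h.1.symm, h.2.2, h.2.1⟩⟩
      loopless := ⟨fun _ h => h.1.ne rfl⟩ }
  let H2 : SimpleGraph V := 
    { Adj := fun x y => H.Adj x y ∧ (x ∈ U ∨ y ∈ U)
      symm := ⟨fun _ _ h => ⟨h.1.symm, h.2.symm⟩⟩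
      loopless := ⟨fun _ h => h.1.ne rfl⟩ }
  have hF : ∀ x s, x ∈ B (false :: s) → x ∉ U := fun x s hx => hU x _ hx (by simp)
  refine ⟨b, hb, H1, H2, fun _ _ h => h.1, fun _ _ h => h.1, ?_, ?_, ?_⟩
  · rintro x y ⟨-, hx, hy⟩ ⟨-, h | h⟩
    · exact hx h
    · exact hy h
  · refine ⟨_, h.sub (H' := H1) false ?_, a', ha', ?_⟩
    · intro x y s hx hy hxy
      obtain ⟨s', hs'⟩ := Set.mem_iUnion.1 hy
      exact ⟨hxy, hF _ _ hx, hF _ _ hs'⟩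
    · have hr : H1.Reachable b a := by
        have hc : (H1.induce (B [])).Connected := by
          refine (h.conn []).mono ?_
          intro x y hxy
          exact ⟨hxy, hU _ _ x.2 (by simp), hU _ _ y.2 (by simp)⟩
        exact (hc.preconnected ⟨b, hb⟩ ⟨a, ha⟩).map (Embedding.induce (G := H1) (B [])).toHom
      refine hr.trans (Adj.reachable ⟨haa, hU _ _ ha (by simp), hF _ _ ha'⟩)
  · refine ⟨_, h.sub (H' := H2) true ?_, b', hb', ?_⟩
    · intro x y s hx hy hxy
      exact ⟨hxy, Or.inr hy⟩
    · exact Adj.reachable ⟨hbb, Or.inr (Set.mem_iUnion.2 ⟨[], hb'⟩)⟩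

lemma Arm.exists_inv {H : SimpleGraph V} {v : V} (h : Arm H v) :
    ∃ w, v ≠ w ∧ H.Reachable v w ∧ Inv H w := by
  obtain ⟨B, hB, a, ha, hva⟩ := h
  have key : ∀ t, ∃ w ∈ B [t], H.Reachable v w ∧ Inv H w := by
    intro t
    have hsub : Model H (fun s => B (t :: s)) := hB.sub t (fun _ _ _ _ _ h => h)
    obtain ⟨w, hw, hinv⟩ := hsub.exists_inv
    obtain ⟨x, hx, y, hy, hxy⟩ := hB.adj [] t
    exact ⟨w, hw, ((hva.trans (hB.reach ha hx)).trans hxy.reachable).trans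
      (hB.reach (s := [t]) hy hw), hinv⟩
  obtain ⟨w, hw, h1, h2⟩ := key true
  obtain ⟨w', hw', h1', h2'⟩ := key false
  by_cases hvw : v = w
  · refine ⟨w', fun h => ?_, h1', h2'⟩
    exact Set.disjoint_left.1 (hB.dis [true] [false] (by simp)) hw (by rw [← hvw, h]; exact hw')
  · exact ⟨w, hvw, h1, h2⟩

theorem backward {T : SimpleGraph V} (h : IsMinor binTree T) : CatWin T := by
  obtain ⟨B, h1, h2, h3⟩ := h
  have hB : Model T B := by
    refine ⟨h1, fun s s' hne => h2 hne, fun s t => h3 _ _ ?_⟩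
    rw [binTree, fromRel_adj]
    exact ⟨by simp, Or.inl ⟨t, rfl⟩⟩
  obtain ⟨w, -, hw⟩ := hB.exists_inv
  refine ⟨w, {p | Inv p.1 p.2}, hw, ?_⟩
  rintro ⟨G, v⟩ ⟨H, H', hH, hH', hd, hA, hA'⟩
  dsimp only at *
  constructor
  · obtain ⟨w, hne, ⟨p⟩, -⟩ := hA.exists_inv
    cases p with
    | nil => exact absurd rfl hne
    | cons hadj _ => exact ⟨_, hH hadj⟩
  · intro e he
    have key : ∀ H : SimpleGraph V, H ≤ G → Arm H v → e ∉ H.edgeSet →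
        ∃ w, CatMove (G.deleteEdges {e}) v w ∧ Inv (G.deleteEdges {e}) w := by
      intro H hH hA he
      have hle : H ≤ G.deleteEdges {e} := by
        intro a b hab
        rw [deleteEdges_adj]
        refine ⟨hH hab, fun h => he ?_⟩
        rw [← Set.mem_singleton_iff.1 h]
        exact hab
      obtain ⟨w, hne, hr, hw⟩ := hA.exists_inv
      exact ⟨w, ⟨hne, hr.mono hle⟩, hw.mono hle⟩
    by_cases heH : e ∈ H.edgeSet
    · refine key H' hH' hA' ?_
      induction e with
      | h a b => exact hd a b heH
    · exact key H hH hA heH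

end CatHerd

/-- a tree is cat-win iff it contains an infinite complete binary
tree minor. -/
theorem tree_catWin_iff {V : Type u} (T : SimpleGraph V) (ht : T.IsTree) :
    CatWin T ↔ IsMinor binTree T := 
  ⟨CatHerd.forward ht, CatHerd.backward⟩
end

section
/- A graph G (possibly infinite) is cat-win if and only if G contains an infinite complete binary tree minor or G contains a 2-edge-connected subgraph with infinitely many vertices. -/
open SimpleGraph

universe u

section Menger
variable {V : Type u} {G : SimpleGraph V}

lemma first_hit {x y : V} (R : G.Walk x y) (S : Set V) (hy : y ∈ S) :
    ∃ z ∈ S, ∃ R' : G.Walk x z, ∀ e ∈ R'.edges, e ∈ R.edges ∧ ∃ a ∈ e, a ∉ S := by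
  induction R with
  | nil => exact ⟨_, hy, .nil, by simp⟩
  | @cons x b c h R ih =>
    by_cases hx : x ∈ S
    · exact ⟨x, hx, .nil, by simp⟩
    · obtain ⟨z, hz, R', hR'⟩ := ih hy
      refine ⟨z, hz, .cons h R', ?_⟩
      intro e he
      rw [Walk.edges_cons, List.mem_cons] at he
      rcases he with rfl | he
      · exact ⟨by simp, x, by simp, hx⟩
      · exact ⟨by simp [(hR' e he).1], (hR' e he).2⟩

def DW (G : SimpleGraph V) (u w : V) : Prop :=
  ∃ p q : G.Walk u w, p.IsPath ∧ q.IsPath ∧ ∀ e ∈ p.edges, e ∉ q.edges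

lemma DW.mk {u w : V} (p q : G.Walk u w) (h : ∀ e ∈ p.edges, e ∉ q.edges) : DW G u w := by
  classical
  exact ⟨p.bypass, q.bypass, p.bypass_isPath, q.bypass_isPath, fun e he hq =>
    h e (p.edges_bypass_subset_edges he) (q.edges_bypass_subset_edges hq)⟩

lemma dw_aux1 {u w w' : V} (P Q : G.Walk u w) (hP : P.IsPath)
    (h : ∀ e ∈ P.edges, e ∉ Q.edges) (hadj : G.Adj w w') (hw : w' ∈ P.support) : DW G u w' := by
  classical
  by_cases hQ : w' ∈ Q.support
  · exact DW.mk (P.takeUntil w' hw) (Q.takeUntil w' hQ) fun e he he' =>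
      h e (P.edges_takeUntil_subset_edges hw he) (Q.edges_takeUntil_subset_edges hQ he')
  · refine DW.mk (P.takeUntil w' hw) (Q.concat hadj) fun e he he' => ?_
    rw [Walk.edges_concat, List.concat_eq_append, List.mem_append, List.mem_singleton] at he'
    rcases he' with he' | rfl
    · exact h e (P.edges_takeUntil_subset_edges hw he) he'
    · exact Walk.endpoint_notMem_support_takeUntil hP hw hadj.ne
        (Walk.fst_mem_support_of_mem_edges _ he)

lemma dw_aux2 {u w w' z : V} (P Q : G.Walk u w) (S : Set V)
    (h : ∀ e ∈ P.edges, e ∉ Q.edges) (hadj : G.Adj w w') (hwP : w' ∉ P.support)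
    (hQS : ∀ x ∈ Q.support, x ∈ S)
    (hz : z ∈ P.support) (R' : G.Walk w' z) (hR : ∀ e ∈ R'.edges, e ≠ s(w, w') ∧ ∃ a ∈ e, a ∉ S) :
    DW G u w' := by
  classical
  refine DW.mk ((P.takeUntil z hz).append R'.reverse) (Q.concat hadj) fun e he he' => ?_
  rw [Walk.edges_concat, List.concat_eq_append, List.mem_append, List.mem_singleton] at he'
  rw [Walk.edges_append, List.mem_append, Walk.edges_reverse, List.mem_reverse] at he
  rcases he with he | he
  · have hp := P.edges_takeUntil_subset_edges hz he
    rcases he' with he' | rfl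
    · exact h e hp he'
    · exact hwP (Walk.snd_mem_support_of_mem_edges _ hp)
  · rcases he' with he' | rfl
    · obtain ⟨a, ha, haS⟩ := (hR e he).2
      induction e with
      | h b c =>
        rcases Sym2.mem_iff.1 ha with rfl | rfl
        · exact haS (hQS _ (Walk.fst_mem_support_of_mem_edges _ he'))
        · exact haS (hQS _ (Walk.snd_mem_support_of_mem_edges _ he'))
    · exact (hR _ he).1 rfl

lemma dw_step {u w w' : V} (hd : DW G u w) (hadj : G.Adj w w')
    (hr : (G.deleteEdges {s(w, w')}).Reachable w' w) : DW G u w' := by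
  obtain ⟨P, Q, hP, hQ, h⟩ := hd
  have h' : ∀ e ∈ Q.edges, e ∉ P.edges := fun e he he' => h e he' he
  by_cases h1 : w' ∈ P.support
  · exact dw_aux1 P Q hP h hadj h1
  by_cases h2 : w' ∈ Q.support
  · exact dw_aux1 Q P hQ h' hadj h2
  rw [reachable_deleteEdges_iff_exists_walk] at hr
  obtain ⟨R, hR⟩ := hr
  obtain ⟨z, hz, R', hR'⟩ := first_hit R {x | x ∈ P.support ∨ x ∈ Q.support} (by simp)
  have hR'' : ∀ e ∈ R'.edges, e ≠ s(w, w') ∧ ∃ a ∈ e, a ∉ {x | x ∈ P.support ∨ x ∈ Q.support} :=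
    fun e he => ⟨fun h => hR (h ▸ (hR' e he).1), (hR' e he).2⟩
  rcases hz with hz | hz
  · exact dw_aux2 P Q _ h hadj h1 (fun x hx => Or.inr hx) hz R' hR''
  · exact dw_aux2 Q P _ h' hadj h2 (fun x hx => Or.inl hx) hz R' hR''

lemma dw_of_edgeReachable {u w : V} (h : G.IsEdgeReachable 2 u w) : DW G u w := by
  classical
  obtain ⟨p, hp⟩ := (h.reachable (by norm_num)).exists_isPath
  have key : ∀ x ∈ p.support, G.IsEdgeReachable 2 u x := fun x hx =>
    hp.isTrail.isEdgeReachable_two_of_isEdgeReachable_two h p.start_mem_support hx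
  have : ∀ {a b : V} (p : G.Walk a b), (∀ x ∈ p.support, G.IsEdgeReachable 2 u x) →
      DW G u a → DW G u b := by
    intro a b p
    induction p with
    | nil => exact fun _ h => h
    | @cons a b c hab p ih =>
      intro hs hd
      refine ih (fun x hx => hs x (by simp [hx])) (dw_step hd hab ?_)
      have h1 := hs a (by simp)
      have h2 := hs b (by simp)
      exact isEdgeReachable_two.1 (h2.symm.trans h1) _
  exact this p key (DW.mk .nil .nil (by simp))

/-- The 2-edge-connected class. -/
def KK (G : SimpleGraph V) (v : V) : Set V := {w | G.IsEdgeReachable 2 v w}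

lemma walk_induce_aux (s : Set V) {a b : V} (p : G.Walk a b) :
    ∀ (hs : ∀ x ∈ p.support, x ∈ s), ∃ p' : (G.induce s).Walk
      ⟨a, hs a p.start_mem_support⟩ ⟨b, hs b p.end_mem_support⟩,
      p'.support.map Subtype.val = p.support ∧ p'.edges.map (Sym2.map Subtype.val) = p.edges := by
  induction p with
  | nil => exact fun hs => ⟨.nil, by simp, by simp⟩
  | @cons a b c hab p ih =>
    intro hs
    obtain ⟨p', h1, h2⟩ := ih (fun x hx => hs x (by simp [hx]))
    have hadj : (G.induce s).Adj ⟨a, hs a (by simp)⟩ ⟨b, hs b (by simp)⟩ := by simpa using hab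
    exact ⟨.cons hadj p', by simp [h1], by simp [h2]⟩

lemma tec_induce_KK (v : V) : TwoEdgeConnected (G.induce (KK G v)) := by
  rintro ⟨a, ha⟩ ⟨b, hb⟩ -
  have hab : G.IsEdgeReachable 2 a b := ha.symm.trans hb
  obtain ⟨p, q, hp, hq, hpq⟩ := dw_of_edgeReachable hab
  have H : ∀ (r : G.Walk a b), r.IsPath → ∀ x ∈ r.support, x ∈ KK G v := fun r hr x hx =>
    IsEdgeReachable.trans ha
      (hr.isTrail.isEdgeReachable_two_of_isEdgeReachable_two hab r.start_mem_support hx)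
  obtain ⟨p', p1, p2⟩ := walk_induce_aux _ p (H p hp)
  obtain ⟨q', q1, q2⟩ := walk_induce_aux _ q (H q hq)
  refine ⟨p', q', ?_, ?_, ?_⟩
  · exact Walk.IsPath.mk' (List.Nodup.of_map Subtype.val (by rw [p1]; exact hp.support_nodup))
  · exact Walk.IsPath.mk' (List.Nodup.of_map Subtype.val (by rw [q1]; exact hq.support_nodup))
  · intro e he he'
    refine hpq (e.map Subtype.val) ?_ ?_
    · rw [← p2]; exact List.mem_map_of_mem he
    · rw [← q2]; exact List.mem_map_of_mem he'

lemma exists_sub_of_KK (v : V) (h : (KK G v).Infinite) :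
    ∃ H : G.Subgraph, H.verts.Infinite ∧ TwoEdgeConnected H.coe := by
  refine ⟨(⊤ : G.Subgraph).induce (KK G v), h, ?_⟩
  rw [← induce_eq_coe_induce_top]
  exact tec_induce_KK v

lemma KK_of_sub (H : G.Subgraph) (hi : H.verts.Infinite) (ht : TwoEdgeConnected H.coe) :
    ∃ v, (KK G v).Infinite := by
  obtain ⟨v, hv⟩ := hi.nonempty
  refine ⟨v, hi.mono ?_⟩
  intro w hw
  by_cases hvw : v = w
  · subst hvw; exact IsEdgeReachable.rfl
  obtain ⟨p, q, -, -, hpq⟩ := ht ⟨v, hv⟩ ⟨w, hw⟩ (by simpa using hvw)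
  refine isEdgeReachable_two.2 fun e => ?_
  have key : ∀ r : H.coe.Walk ⟨v, hv⟩ ⟨w, hw⟩, e ∉ (r.map H.hom).edges →
      (G.deleteEdges {e}).Reachable v w := by
    intro r hr
    exact ⟨(r.map H.hom).toDeleteEdge e hr⟩
  by_cases h1 : e ∈ (p.map H.hom).edges
  · apply key q
    intro h2
    rw [Walk.edges_map, List.mem_map] at h1 h2
    obtain ⟨e1, h1, rfl⟩ := h1
    obtain ⟨e2, h2, h3⟩ := h2
    have := Sym2.map.injective (f := H.hom) Subtype.val_injective h3
    subst this
    exact hpq _ h1 h2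
  · exact key p h1

end Menger
section Game
variable {V : Type u} {G : SimpleGraph V}

lemma reach_del (H : SimpleGraph V) (c d : V) {x y : V} (h : H.Reachable x y) :
    (H.deleteEdges {s(c, d)}).Reachable x y ∨
    ((H.deleteEdges {s(c, d)}).Reachable x c ∧ (H.deleteEdges {s(c, d)}).Reachable d y) ∨
    ((H.deleteEdges {s(c, d)}).Reachable x d ∧ (H.deleteEdges {s(c, d)}).Reachable c y) := by
  obtain ⟨p⟩ := h
  induction p with
  | nil => exact Or.inl .rfl
  | @cons x b y hxb p ih =>
    by_cases hf : s(x, b) = s(c, d)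
    · rcases Sym2.eq_iff.1 hf with ⟨rfl, rfl⟩ | ⟨rfl, rfl⟩
      · rcases ih with h | ⟨h1, h2⟩ | ⟨h1, h2⟩
        · exact Or.inr (Or.inl ⟨.rfl, h⟩)
        · exact Or.inr (Or.inl ⟨.rfl, h2⟩)
        · exact Or.inl h2
      · rcases ih with h | ⟨h1, h2⟩ | ⟨h1, h2⟩
        · exact Or.inr (Or.inr ⟨.rfl, h⟩)
        · exact Or.inl h2
        · exact Or.inr (Or.inr ⟨.rfl, h2⟩)
    · have hx : (H.deleteEdges {s(c, d)}).Reachable x b :=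
        Adj.reachable (by rw [deleteEdges_adj]; exact ⟨hxb, by simpa using hf⟩)
      rcases ih with h | ⟨h1, h2⟩ | ⟨h1, h2⟩
      · exact Or.inl (hx.trans h)
      · exact Or.inr (Or.inl ⟨hx.trans h1, h2⟩)
      · exact Or.inr (Or.inr ⟨hx.trans h1, h2⟩)

lemma win_adj {H : SimpleGraph V} {v : V} (h : CatWinFrom H v) : ∃ w, H.Adj v w := by
  obtain ⟨S, hv, hS⟩ := h
  exact (hS _ hv).1

lemma win_move {H : SimpleGraph V} {v : V} (h : CatWinFrom H v) {e : Sym2 V}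
    (he : e ∈ H.edgeSet) : ∃ w, CatMove (H.deleteEdges {e}) v w ∧
      CatWinFrom (H.deleteEdges {e}) w := by
  obtain ⟨S, hv, hS⟩ := h
  obtain ⟨w, hw, hw'⟩ := (hS _ hv).2 e he
  exact ⟨w, hw, S, hw', hS⟩

lemma del_mono {H H' : SimpleGraph V} (h : H ≤ H') (s : Set (Sym2 V)) :
    H.deleteEdges s ≤ H'.deleteEdges s := by
  intro a b hab
  rw [deleteEdges_adj] at hab ⊢
  exact ⟨h hab.1, hab.2⟩

lemma le_del {H H' : SimpleGraph V} (h : H ≤ H') {e : Sym2 V} (he : e ∉ H.edgeSet) :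
    H ≤ H'.deleteEdges {e} := by
  intro a b hab
  rw [deleteEdges_adj]
  refine ⟨h hab, ?_⟩
  rintro rfl
  exact he hab

lemma win_mono {H H' : SimpleGraph V} (h : H ≤ H') {v : V} (hw : CatWinFrom H v) :
    CatWinFrom H' v := by
  refine ⟨{p | ∃ K, K ≤ p.1 ∧ CatWinFrom K p.2}, ⟨H, h, hw⟩, ?_⟩
  rintro ⟨P, x⟩ ⟨K, hK, hwin⟩
  dsimp only at hK hwin ⊢
  obtain ⟨y, hy⟩ := win_adj hwin
  refine ⟨⟨y, hK hy⟩, ?_⟩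
  intro e he
  by_cases heK : e ∈ K.edgeSet
  · obtain ⟨w, ⟨h1, h2⟩, h3⟩ := win_move hwin heK
    exact ⟨w, ⟨h1, h2.mono (del_mono hK _)⟩, _, del_mono hK _, h3⟩
  · obtain ⟨w, ⟨h1, h2⟩, h3⟩ := win_move hwin (e := s(x, y)) hy
    have hle : K.deleteEdges {s(x, y)} ≤ P.deleteEdges {e} :=
      (deleteEdges_le _).trans (le_del hK heK)
    exact ⟨w, ⟨h1, h2.mono hle⟩, _, hle, h3⟩

def Good (H : SimpleGraph V) (v : V) : Prop := ∃ w, H.Reachable v w ∧ CatWinFrom H w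

lemma Good.of_reach {H : SimpleGraph V} {v w : V} (h : Good H v) (hr : H.Reachable w v) :
    Good H w := by
  obtain ⟨x, h1, h2⟩ := h
  exact ⟨x, hr.trans h1, h2⟩

lemma split_aux {H : SimpleGraph V} {v : V} (hw : CatWinFrom H v)
    (hno : ∀ a b, H.Adj a b → ¬ (H.deleteEdges {s(a, b)}).Reachable a b → H.Reachable v a →
      Good (H.deleteEdges {s(a, b)}) a → Good (H.deleteEdges {s(a, b)}) b → False)
    {H' : SimpleGraph V} (hle : H' ≤ H) {v' w : V} (hv' : v' ∈ KK H v) (hwK : w ∉ KK H v)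
    (hr : H'.Reachable v' w) (hwin : CatWinFrom H' w) : False := by
  have : ∃ f, ¬ (H.deleteEdges {f}).Reachable v w := by
    by_contra hcon
    push Not at hcon
    exact hwK (isEdgeReachable_two.2 hcon)
  obtain ⟨f, hf⟩ := this
  have hvv' : (H.deleteEdges {f}).Reachable v v' := isEdgeReachable_two.1 hv' f
  have hfH' : f ∈ H'.edgeSet := by
    by_contra hcon
    exact hf (hvv'.trans (hr.mono (le_del hle hcon)))
  obtain ⟨x, ⟨-, hx⟩, hxw⟩ := win_move hwin hfH'
  have g1 : Good (H.deleteEdges {f}) w := ⟨x, hx.mono (del_mono hle _), win_mono (del_mono hle _) hxw⟩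
  have hfH : f ∈ H.edgeSet := edgeSet_mono hle hfH'
  obtain ⟨y, ⟨-, hy⟩, hyw⟩ := win_move hw hfH
  have g2 : Good (H.deleteEdges {f}) v := ⟨y, hy, hyw⟩
  have hvw : H.Reachable v w := (hvv'.mono (deleteEdges_le _)).trans (hr.mono hle)
  induction f with
  | h c d =>
    rcases reach_del H c d hvw with h | ⟨h1, h2⟩ | ⟨h1, h2⟩
    · exact hf h
    · exact hno c d hfH (fun h => hf (h1.trans (h.trans h2))) (h1.mono (deleteEdges_le _))
        (g2.of_reach h1.symm) (g1.of_reach h2)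
    · refine hno c d hfH (fun h => hf (h1.trans (h.symm.trans h2)))
        (hvw.trans (h2.mono (deleteEdges_le _)).symm) (g1.of_reach h2) (g2.of_reach h1.symm)

lemma split_ind {H : SimpleGraph V} {v : V} (hw : CatWinFrom H v) (hfin : (KK H v).Finite)
    (hno : ∀ a b, H.Adj a b → ¬ (H.deleteEdges {s(a, b)}).Reachable a b → H.Reachable v a →
      Good (H.deleteEdges {s(a, b)}) a → Good (H.deleteEdges {s(a, b)}) b → False)
    (n : ℕ) : ∀ (H' : SimpleGraph V), H' ≤ H → ∀ v' ∈ KK H v, CatWinFrom H' v' →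
      ({e | e ∈ H'.edgeSet ∧ ∀ x ∈ e, x ∈ KK H v}).ncard = n → False := by
  have hEfin : ∀ H' : SimpleGraph V, ({e | e ∈ H'.edgeSet ∧ ∀ x ∈ e, x ∈ KK H v}).Finite := by
    intro H'
    refine Set.Finite.subset ((hfin.prod hfin).image (fun p : V × V => s(p.1, p.2))) ?_
    intro e he
    induction e with
    | h a b => exact ⟨(a, b), ⟨he.2 a (by simp), he.2 b (by simp)⟩, rfl⟩
  induction n using Nat.strong_induction_on with
  | _ n ih =>
    intro H' hle v' hv' hwin hn
    by_cases hE : ∃ e, e ∈ H'.edgeSet ∧ ∀ x ∈ e, x ∈ KK H v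
    · obtain ⟨e, he, heK⟩ := hE
      obtain ⟨w, ⟨-, hr⟩, hww⟩ := win_move hwin he
      have hle' : H'.deleteEdges {e} ≤ H := (deleteEdges_le _).trans hle
      by_cases hwK : w ∈ KK H v
      · refine ih _ ?_ _ hle' w hwK hww rfl
        rw [← hn]
        refine Set.ncard_lt_ncard ?_ (hEfin _)
        rw [Set.ssubset_iff_of_subset]
        · refine ⟨e, ⟨he, heK⟩, ?_⟩
          rintro ⟨h, -⟩
          simp [edgeSet_deleteEdges] at h
        · rintro f ⟨h1, h2⟩
          exact ⟨edgeSet_mono (deleteEdges_le _) h1, h2⟩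
      · exact split_aux hw hno hle' hv' hwK hr hww
    · push Not at hE
      obtain ⟨u, hu⟩ := win_adj hwin
      obtain ⟨w, ⟨hne, hr⟩, hww⟩ := win_move hwin (e := s(v', u)) hu
      have hle' : H'.deleteEdges {s(v', u)} ≤ H := (deleteEdges_le _).trans hle
      by_cases hwK : w ∈ KK H v
      · classical
        obtain ⟨p, hp⟩ := (hr.mono (deleteEdges_le _) : H'.Reachable v' w).exists_isPath
        cases p with
        | nil => exact hne rfl
        | @cons _ x _ hx p =>
          obtain ⟨y, hy, hyK⟩ := hE s(v', x) hx
          have hxK : x ∉ KK H v := by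
            rcases Sym2.mem_iff.1 hy with rfl | rfl
            · exact absurd hv' hyK
            · exact hyK
          refine hxK (IsEdgeReachable.trans hv' ?_)
          have h2 : H.IsEdgeReachable 2 v' w := IsEdgeReachable.trans (IsEdgeReachable.symm hv') hwK
          have hp' := (Walk.isPath_mapLe hle).2 hp
          exact hp'.isTrail.isEdgeReachable_two_of_isEdgeReachable_two h2 (Walk.start_mem_support _)
            (by simp)
      · exact split_aux hw hno hle' hv' hwK hr hww

lemma split {H : SimpleGraph V} {v : V} (hw : CatWinFrom H v) (hfin : (KK H v).Finite) :
    ∃ a b, H.Adj a b ∧ ¬ (H.deleteEdges {s(a, b)}).Reachable a b ∧ H.Reachable v a ∧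
      Good (H.deleteEdges {s(a, b)}) a ∧ Good (H.deleteEdges {s(a, b)}) b := by
  by_contra hcon
  push Not at hcon
  exact split_ind hw hfin (fun a b h1 h2 h3 h4 h5 => hcon a b h1 h2 h3 h4 h5) _ H le_rfl v
    IsEdgeReachable.rfl hw rfl

/-- infinite class gives cat win -/
lemma KK_step {H : SimpleGraph V} {v : V} (hinf : (KK H v).Infinite) (e : Sym2 V) :
    ∃ w, CatMove (H.deleteEdges {e}) v w ∧ (KK (H.deleteEdges {e}) w).Infinite := by
  induction e with
  | h a b =>
  set H' := H.deleteEdges {s(a, b)} with hH'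
  let F : Set (Sym2 V) := {f | H'.Reachable a b ∧ ¬ (H'.deleteEdges {f}).Reachable a b}
  have hF : F.Finite := by
    by_cases hab : H'.Reachable a b
    · obtain ⟨p⟩ := hab
      refine (List.finite_toSet p.edges).subset ?_
      rintro f ⟨-, hf⟩
      by_contra hcon
      exact hf ⟨p.toDeleteEdge f hcon⟩
    · exact Set.Finite.subset Set.finite_empty (fun f hf => hab hf.1)
  let φ : V → Set (Sym2 V) := fun x => {f | f ∈ F ∧ (H'.deleteEdges {f}).Reachable x a}
  have himg : (φ '' KK H v).Finite := by
    refine hF.finite_subsets.subset ?_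
    rintro _ ⟨x, -, rfl⟩
    exact fun f hf => hf.1
  have : ∃ c, (KK H v ∩ φ ⁻¹' {c}).Infinite := by
    by_contra hcon
    push Not at hcon
    exact hinf (Set.Finite.of_finite_fibers φ himg (fun c _ => by simpa using hcon c))
  obtain ⟨c, hc⟩ := this
  obtain ⟨w, hw, hwv⟩ := (hc.sdiff (Set.finite_singleton v)).nonempty
  refine ⟨w, ⟨fun h => hwv h.symm, isEdgeReachable_two.1 hw.1 _⟩, hc.mono ?_⟩
  rintro x ⟨hxK, hxc⟩
  refine isEdgeReachable_two.2 fun f => ?_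
  by_contra hcon
  have hφ : φ w = φ x := hw.2.trans hxc.symm
  have hwx : H.IsEdgeReachable 2 w x := IsEdgeReachable.trans (IsEdgeReachable.symm hw.1) hxK
  have h1 := isEdgeReachable_two.1 hwx f
  have h0 : H'.Reachable w x := isEdgeReachable_two.1 hwx s(a, b)
  have hcomm : (H.deleteEdges {f}).deleteEdges {s(a, b)} = H'.deleteEdges {f} := by
    rw [hH', deleteEdges_deleteEdges, deleteEdges_deleteEdges, Set.union_comm]
  have h2 := reach_del _ a b h1
  rw [hcomm] at h2
  have hle : H'.deleteEdges {f} ≤ H' := deleteEdges_le _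
  have memφ : ∀ y, f ∈ φ y ↔ f ∈ F ∧ (H'.deleteEdges {f}).Reachable y a := fun y => Iff.rfl
  rcases h2 with h | ⟨h3, h4⟩ | ⟨h3, h4⟩
  · exact hcon h
  · have hf : f ∈ F := ⟨(h3.mono hle).symm.trans (h0.trans (h4.mono hle).symm),
      fun h => hcon (h3.trans (h.trans h4))⟩
    have : f ∈ φ x := hφ ▸ (memφ w).2 ⟨hf, h3⟩
    exact hcon (h3.trans this.2.symm)
  · have hf : f ∈ F := ⟨(h4.mono hle).trans (h0.symm.trans (h3.mono hle)),
      fun h => hcon (h3.trans (h.symm.trans h4))⟩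
    have : f ∈ φ w := hφ ▸ (memφ x).2 ⟨hf, h4.symm⟩
    exact hcon (this.2.trans h4)

lemma adj_of_reach {H : SimpleGraph V} {v w : V} (h : H.Reachable v w) (hne : v ≠ w) :
    ∃ x, H.Adj v x := by
  obtain ⟨p⟩ := h
  cases p with
  | nil => exact absurd rfl hne
  | cons h _ => exact ⟨_, h⟩

lemma win_of_KK {H : SimpleGraph V} {v : V} (hinf : (KK H v).Infinite) : CatWinFrom H v := by
  refine ⟨{p | (KK p.1 p.2).Infinite}, hinf, ?_⟩
  rintro ⟨P, x⟩ hx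
  refine ⟨?_, fun e _ => KK_step hx e⟩
  obtain ⟨w, hw, hwv⟩ := (Set.Infinite.sdiff hx (Set.finite_singleton x)).nonempty
  exact adj_of_reach (IsEdgeReachable.reachable (by norm_num) hw) (fun h => hwv h.symm)

end Game
section Tree
variable {V : Type u} {G : SimpleGraph V}

def RG (G : SimpleGraph V) (A : Set V) : SimpleGraph V where
  Adj a b := G.Adj a b ∧ a ∈ A ∧ b ∈ A
  symm := ⟨fun _ _ h => ⟨h.1.symm, h.2.2, h.2.1⟩⟩
  loopless := ⟨fun _ h => G.irrefl h.1⟩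

def Conn (G : SimpleGraph V) (A : Set V) : Prop :=
  ∀ x ∈ A, ∀ y ∈ A, (RG G A).Reachable x y

lemma RG_mono {A B : Set V} (h : A ⊆ B) : RG G A ≤ RG G B :=
  fun _ _ hab => ⟨hab.1, h hab.2.1, h hab.2.2⟩

lemma RG_le (A : Set V) : RG G A ≤ G := fun _ _ h => h.1

lemma conn_of_induce {A : Set V} (h : (G.induce A).Connected) : Conn G A := by
  intro x hx y hy
  have := h.preconnected ⟨x, hx⟩ ⟨y, hy⟩
  let f : G.induce A →g RG G A := ⟨Subtype.val, fun {a b} hab => ⟨by simpa using hab, a.2, b.2⟩⟩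
  exact this.map f

lemma induce_of_conn {A : Set V} (h : Conn G A) (hne : A.Nonempty) : (G.induce A).Connected := by
  have key : ∀ {x y : V} (_ : (RG G A).Walk x y) (hx : x ∈ A) (hy : y ∈ A),
      (G.induce A).Reachable ⟨x, hx⟩ ⟨y, hy⟩ := by
    intro x y p
    induction p with
    | nil => exact fun _ _ => .rfl
    | @cons x b y hab p ih =>
      intro hx hy
      have : (G.induce A).Adj ⟨x, hx⟩ ⟨b, hab.2.2⟩ := by simpa using hab.1
      exact this.reachable.trans (ih _ hy)
  have : Nonempty A := hne.to_subtype
  refine ⟨?_⟩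
  rintro ⟨x, hx⟩ ⟨y, hy⟩
  obtain ⟨p⟩ := h x hx y hy
  exact key p hx hy

lemma conn_comp {H : SimpleGraph V} (hle : H ≤ G) (v : V) : Conn G {w | H.Reachable v w} := by
  have key : ∀ {x y : V} (_ : H.Walk x y), H.Reachable v x →
      (RG G {w | H.Reachable v w}).Reachable x y := by
    intro x y p
    induction p with
    | nil => exact fun _ => .rfl
    | @cons x b y hab p ih =>
      intro hx
      have hb : H.Reachable v b := hx.trans hab.reachable
      have : (RG G {w | H.Reachable v w}).Adj x b := ⟨hle hab, hx, hb⟩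
      exact this.reachable.trans (ih hb)
  intro x hx y hy
  obtain ⟨p⟩ := (hx : H.Reachable v x).symm.trans hy
  exact key p hx

/-- the component of `r` inside the set `X` -/
def comp (G : SimpleGraph V) (X : Set V) (r : V) : Set V := {w | (RG G X).Reachable r w}

lemma conn_comp' (X : Set V) (r : V) : Conn G (comp G X r) :=
  conn_comp (H := RG G X) (fun _ _ h => h.1) r

lemma comp_sub {X : Set V} {r : V} (hr : r ∈ X) : comp G X r ⊆ X := by
  have key : ∀ {x y : V} (_ : (RG G X).Walk x y), x ∈ X → y ∈ X := by
    intro x y p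
    induction p with
    | nil => exact fun h => h
    | @cons x b y hab p ih => exact fun _ => ih hab.2.2
  rintro w ⟨p⟩
  exact key p hr

/-- crossing lemma -/
lemma exit_lemma {A Y : Set V} {x y : V} (h : (RG G A).Reachable x y) (hx : x ∉ Y) (hy : y ∈ Y) :
    ∃ a b, (RG G (A \ Y)).Reachable x a ∧ G.Adj a b ∧ b ∈ Y := by
  obtain ⟨p⟩ := h
  induction p with
  | nil => exact absurd hy hx
  | @cons x b y hab p ih =>
    by_cases hb : b ∈ Y
    · exact ⟨x, b, .rfl, hab.1, hb⟩
    · obtain ⟨a, c, h1, h2, h3⟩ := ih hb hy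
      have : (RG G (A \ Y)).Adj x b := ⟨hab.1, ⟨hab.2.1, hx⟩, ⟨hab.2.2, hb⟩⟩
      exact ⟨a, c, this.reachable.trans h1, h2, h3⟩

def Fam (G : SimpleGraph V) (T : Set (Set V)) : Prop :=
  ∀ A ∈ T, A.Nonempty ∧ Conn G A ∧ ∃ A0 ∈ T, ∃ A1 ∈ T, A0 ⊆ A ∧ A1 ⊆ A ∧ Disjoint A0 A1

lemma fam_avoid {T : Set (Set V)} (hT : Fam G T) (F : Finset V) :
    ∀ A ∈ T, ∃ A' ∈ T, A' ⊆ A ∧ ∀ x ∈ F, x ∉ A' := by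
  classical
  induction F using Finset.induction_on with
  | empty => exact fun A hA => ⟨A, hA, subset_rfl, by simp⟩
  | insert y F hy ih =>
    intro A hA
    obtain ⟨A', hA', hs, hF⟩ := ih A hA
    obtain ⟨-, -, A0, h0, A1, h1, s0, s1, hd⟩ := hT A' hA'
    by_cases hy0 : y ∈ A0
    · have hy1 : y ∉ A1 := fun h => Set.disjoint_left.1 hd hy0 h
      exact ⟨A1, h1, s1.trans hs, by
        intro x hx
        rcases Finset.mem_insert.1 hx with rfl | hx
        · exact hy1
        · exact fun h => hF x hx (s1 h)⟩
    · exact ⟨A0, h0, s0.trans hs, by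
        intro x hx
        rcases Finset.mem_insert.1 hx with rfl | hx
        · exact hy0
        · exact fun h => hF x hx (s0 h)⟩

lemma walk_in {A X : Set V} {x y : V} (p : (RG G A).Walk x y) (hs : ∀ z ∈ p.support, z ∈ X) :
    (RG G X).Reachable x y := by
  induction p with
  | nil => exact .rfl
  | @cons x b y hab p ih =>
    have : (RG G X).Adj x b := ⟨hab.1, hs x (by simp), hs b (by simp)⟩
    exact this.reachable.trans (ih (fun z hz => hs z (by simp [hz])))

lemma fam_step {T : Set (Set V)} (hT : Fam G T) {A : Set V} (hA : A ∈ T) {r : V} (hr : r ∈ A) :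
    ∃ (B : Set V) (C : Bool → Set V) (ρ : Bool → V), r ∈ B ∧ B ⊆ A ∧ Conn G B ∧
      (∀ t, C t ∈ T ∧ C t ⊆ A ∧ Disjoint B (C t) ∧ ρ t ∈ C t ∧ ∃ x ∈ B, G.Adj x (ρ t)) ∧
      Disjoint (C false) (C true) := by
  classical
  obtain ⟨-, hc, A0, h0, A1, h1, s0, s1, hd⟩ := hT A hA
  obtain ⟨⟨p0, hp0⟩, c0, -⟩ := hT A0 h0
  obtain ⟨⟨p1, hp1⟩, c1, -⟩ := hT A1 h1
  obtain ⟨P0⟩ := hc r hr p0 (s0 hp0)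
  obtain ⟨P1⟩ := hc r hr p1 (s1 hp1)
  let F : Finset V := P0.support.toFinset ∪ P1.support.toFinset
  obtain ⟨C0, hC0, t0, f0⟩ := fam_avoid hT F A0 h0
  obtain ⟨C1, hC1, t1, f1⟩ := fam_avoid hT F A1 h1
  let X : Set V := A \ (C0 ∪ C1)
  have hFA0 : ∀ z ∈ P0.support, z ∈ X := by
    intro z hz
    have hzF : z ∈ F := by simp [F, hz]
    refine ⟨?_, fun h => h.elim (f0 z hzF) (f1 z hzF)⟩
    exact comp_sub hr (⟨P0.takeUntil z hz⟩ : (RG G A).Reachable r z)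
  have hFA1 : ∀ z ∈ P1.support, z ∈ X := by
    intro z hz
    have hzF : z ∈ F := by simp [F, hz]
    refine ⟨?_, fun h => h.elim (f0 z hzF) (f1 z hzF)⟩
    exact comp_sub hr (⟨P1.takeUntil z hz⟩ : (RG G A).Reachable r z)
  have r0 := walk_in P0 hFA0
  have r1 := walk_in P1 hFA1
  have hrX : r ∈ X := hFA0 r (by simp)
  have hBX : comp G X r ⊆ X := comp_sub hrX
  obtain ⟨⟨q0, hq0⟩, -⟩ := hT C0 hC0
  obtain ⟨⟨q1, hq1⟩, -⟩ := hT C1 hC1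
  obtain ⟨a0, b0, e0, g0, k0⟩ := exit_lemma (Y := C0) (c0 p0 hp0 q0 (t0 hq0))
    (fun h => (hFA0 p0 (by simp)).2 (Or.inl h)) hq0
  obtain ⟨a1, b1, e1, g1, k1⟩ := exit_lemma (Y := C1) (c1 p1 hp1 q1 (t1 hq1))
    (fun h => (hFA1 p1 (by simp)).2 (Or.inr h)) hq1
  have i0 : A0 \ C0 ⊆ X := fun z hz => ⟨s0 hz.1, fun h => h.elim hz.2
    (fun h => Set.disjoint_left.1 hd hz.1 (t1 h))⟩
  have i1 : A1 \ C1 ⊆ X := fun z hz => ⟨s1 hz.1, fun h => h.elim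
    (fun h => Set.disjoint_left.1 hd (t0 h) hz.1) hz.2⟩
  refine ⟨comp G X r, fun t => bif t then C1 else C0, fun t => bif t then b1 else b0, .rfl,
    fun z hz => (hBX hz).1, conn_comp' X r, ?_, hd.mono t0 t1⟩
  intro t
  cases t
  · exact ⟨hC0, t0.trans s0, Set.disjoint_left.2 fun z hz h => (hBX hz).2 (Or.inl h), k0, a0,
      r0.trans (e0.mono (RG_mono i0)), g0⟩
  · exact ⟨hC1, t1.trans s1, Set.disjoint_left.2 fun z hz h => (hBX hz).2 (Or.inr h), k1, a1,
      r1.trans (e1.mono (RG_mono i1)), g1⟩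

lemma minor_of_fam {T : Set (Set V)} (hT : Fam G T) (hne : T.Nonempty) : IsMinor binTree G := by
  let St := {σ : Set V × V // σ.1 ∈ T ∧ σ.2 ∈ σ.1}
  have hstep : ∀ σ : St, ∃ (B : Set V) (C : Bool → St), σ.1.2 ∈ B ∧ B ⊆ σ.1.1 ∧ Conn G B ∧
      (∀ t, (C t).1.1 ⊆ σ.1.1 ∧ Disjoint B (C t).1.1 ∧ ∃ x ∈ B, G.Adj x (C t).1.2) ∧
      Disjoint (C false).1.1 (C true).1.1 := by
    rintro ⟨⟨A, r⟩, hA, hr⟩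
    obtain ⟨B, C, ρ, h1, h2, h3, h4, h5⟩ := fam_step hT hA hr
    exact ⟨B, fun t => ⟨(C t, ρ t), (h4 t).1, (h4 t).2.2.2.1⟩, h1, h2, h3,
      fun t => ⟨(h4 t).2.1, (h4 t).2.2.1, (h4 t).2.2.2.2⟩, h5⟩
  choose B C hrB hBA hconn hC hdis using hstep
  obtain ⟨A, hA⟩ := hne
  obtain ⟨r, hr⟩ := (hT A hA).1
  let Br : List Bool → St → Set V := fun s => List.rec (fun σ => B σ) (fun t _ ih σ => ih (C σ t)) s
  have Br_nil : ∀ σ, Br [] σ = B σ := fun _ => rfl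
  have Br_cons : ∀ t s σ, Br (t :: s) σ = Br s (C σ t) := fun _ _ _ => rfl
  have hsub : ∀ s σ, Br s σ ⊆ σ.1.1 := by
    intro s
    induction s with
    | nil => exact hBA
    | cons t s ih => exact fun σ => (ih (C σ t)).trans (hC σ t).1
  have hdisC : ∀ σ t t', t ≠ t' → Disjoint (C σ t).1.1 (C σ t').1.1 := by
    intro σ t t' h
    cases t <;> cases t'
    · exact absurd rfl h
    · exact hdis σ
    · exact (hdis σ).symm
    · exact absurd rfl h
  have hD : ∀ s t σ, s ≠ t → Disjoint (Br s σ) (Br t σ) := by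
    intro s
    induction s with
    | nil =>
      intro t σ h
      cases t with
      | nil => exact absurd rfl h
      | cons b t => exact (hC σ b).2.1.mono_right (hsub t _)
    | cons b s ih =>
      intro t σ h
      cases t with
      | nil => exact ((hC σ b).2.1.mono_right (hsub s _)).symm
      | cons b' t =>
        by_cases hb : b = b'
        · subst hb
          exact ih t (C σ b) (fun h' => h (by rw [h']))
        · exact (hdisC σ b b' hb).mono (hsub s _) (hsub t _)
  have hcn : ∀ s σ, Conn G (Br s σ) ∧ (Br s σ).Nonempty := by
    intro s
    induction s with
    | nil => exact fun σ => ⟨hconn σ, _, hrB σ⟩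
    | cons t s ih => exact fun σ => ih _
  have hadj : ∀ s t σ, ∃ x ∈ Br s σ, ∃ y ∈ Br (s ++ [t]) σ, G.Adj x y := by
    intro s
    induction s with
    | nil =>
      intro t σ
      obtain ⟨x, hx, h⟩ := (hC σ t).2.2
      exact ⟨x, hx, _, hrB _, h⟩
    | cons b s ih => exact fun t σ => ih t (C σ b)
  let σ0 : St := ⟨(A, r), hA, hr⟩
  refine ⟨fun s => Br s σ0, fun s => induce_of_conn (hcn s σ0).1 (hcn s σ0).2,
    fun s t h => hD s t σ0 h, ?_⟩
  intro s t hst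
  rw [binTree, fromRel_adj] at hst
  obtain ⟨-, ⟨c, rfl⟩ | ⟨c, rfl⟩⟩ := hst
  · exact hadj s c σ0
  · obtain ⟨x, hx, y, hy, h⟩ := hadj t c σ0
    exact ⟨y, hy, x, hx, h.symm⟩

lemma conn_union {A B : Set V} (hA : Conn G A) (hB : Conn G B) {x y : V} (hx : x ∈ A) (hy : y ∈ B)
    (hxy : G.Adj x y) : Conn G (A ∪ B) := by
  have key : ∀ z ∈ A ∪ B, (RG G (A ∪ B)).Reachable x z := by
    rintro z (hz | hz)
    · exact (hA x hx z hz).mono (RG_mono Set.subset_union_left)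
    · have : (RG G (A ∪ B)).Adj x y := ⟨hxy, Or.inl hx, Or.inr hy⟩
      exact this.reachable.trans ((hB y hy z hz).mono (RG_mono Set.subset_union_right))
  exact fun a ha b hb => (key a ha).symm.trans (key b hb)

lemma fam_of_minor (h : IsMinor binTree G) : ∃ T, Fam G T ∧ T.Nonempty := by
  obtain ⟨B, hc, hd, ha⟩ := h
  have hadj : ∀ s t, ∃ x ∈ B s, ∃ y ∈ B (s ++ [t]), G.Adj x y := by
    intro s t
    apply ha
    rw [binTree, fromRel_adj]
    exact ⟨by simp, Or.inl ⟨t, rfl⟩⟩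
  let U : List Bool → Set V := fun s => ⋃ t, B (s ++ t)
  have hsub : ∀ s t, B (s ++ t) ⊆ U s := fun s t => Set.subset_iUnion (fun t => B (s ++ t)) t
  have hU : ∀ s t, U (s ++ t) ⊆ U s := by
    intro s t
    refine Set.iUnion_subset fun t' => ?_
    rw [List.append_assoc]
    exact hsub s _
  have hne : ∀ s, (B s).Nonempty := fun s => Set.nonempty_coe_sort.1 (hc s).nonempty
  refine ⟨Set.range U, ?_, ⟨_, [], rfl⟩⟩
  rintro _ ⟨s, rfl⟩
  obtain ⟨r, hr⟩ := hne s
  have hrU : r ∈ U s := hsub s [] (by simpa using hr)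
  refine ⟨⟨r, hrU⟩, ?_, U (s ++ [false]), ⟨_, rfl⟩, U (s ++ [true]), ⟨_, rfl⟩, hU _ _, hU _ _, ?_⟩
  · have key : ∀ t, ∀ x ∈ B (s ++ t), (RG G (U s)).Reachable r x := by
      intro t
      induction t using List.reverseRecOn with
      | nil =>
        intro x hx
        have := conn_of_induce (hc (s ++ [])) r (by simpa using hr) x hx
        exact this.mono (RG_mono (hsub s []))
      | append_singleton t c ih =>
        intro x hx
        obtain ⟨a, ha, b, hb, hab⟩ := hadj (s ++ t) c
        rw [List.append_assoc] at hb
        have h1 : (RG G (U s)).Adj a b := ⟨hab, hsub _ _ ha, hsub _ _ hb⟩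
        exact ((ih a ha).trans h1.reachable).trans
          ((conn_of_induce (hc _) b hb x hx).mono (RG_mono (hsub s _)))
    intro x hx y hy
    obtain ⟨t, ht⟩ := Set.mem_iUnion.1 hx
    obtain ⟨t', ht'⟩ := Set.mem_iUnion.1 hy
    exact (key t x ht).symm.trans (key t' y ht')
  · rw [Set.disjoint_left]
    intro x hx hy
    obtain ⟨t, ht⟩ := Set.mem_iUnion.1 hx
    obtain ⟨t', ht'⟩ := Set.mem_iUnion.1 hy
    refine Set.disjoint_left.1 (hd ?_) ht ht'
    simp

/-- `A` is connected and contains a member of a family. -/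
def Rich (G : SimpleGraph V) (A : Set V) : Prop :=
  Conn G A ∧ ∃ T, Fam G T ∧ ∃ A' ∈ T, A' ⊆ A

def QQ (G : SimpleGraph V) (v : V) : Prop :=
  ∃ A0 A1, Rich G A0 ∧ Rich G A1 ∧ v ∈ A0 ∧ v ∈ A1 ∧ ∀ x, x ∈ A0 → x ∈ A1 → x = v

lemma QQ_of_fam {T : Set (Set V)} (hT : Fam G T) {A : Set V} (hA : A ∈ T) (v : V) :
    ∃ w ∈ A, v ≠ w ∧ QQ G w := by
  obtain ⟨A', hA', hs, hv⟩ := fam_avoid hT {v} A hA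
  obtain ⟨r, hr⟩ := (hT A' hA').1
  obtain ⟨B, C, ρ, h1, h2, h3, h4, h5⟩ := fam_step hT hA' hr
  obtain ⟨k1, k2, k3, k4, x, k5, k6⟩ := h4 false
  obtain ⟨l1, l2, l3, l4, y, l5, l6⟩ := h4 true
  have hx1 : Conn G {x} := by
    rintro a rfl b rfl
    exact .rfl
  refine ⟨x, hs (h2 k5), ?_, {x} ∪ C false, B ∪ C true, ⟨?_, T, hT, _, k1, Set.subset_union_right⟩,
    ⟨?_, T, hT, _, l1, Set.subset_union_right⟩, Or.inl rfl, Or.inl k5, ?_⟩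
  · rintro rfl
    exact hv v (by simp) (h2 k5)
  · exact conn_union hx1 (hT _ k1).2.1 rfl k4 k6
  · exact conn_union h3 (hT _ l1).2.1 l5 l4 l6
  · rintro z (hz | hz) (hz' | hz')
    · exact hz
    · exact hz
    · exact absurd hz (Set.disjoint_left.1 k3 hz')
    · exact absurd hz' (Set.disjoint_left.1 h5 hz)

lemma RG_del {A A' : Set V} (hs : A' ⊆ A) {a b : V} (h : ¬ (a ∈ A ∧ b ∈ A)) :
    RG (G.deleteEdges {s(a, b)}) A' = RG G A' := by
  ext x y
  simp only [RG, deleteEdges_adj, Set.mem_singleton_iff]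
  constructor
  · rintro ⟨⟨h1, -⟩, h2⟩
    exact ⟨h1, h2⟩
  · rintro ⟨h1, h2⟩
    refine ⟨⟨h1, fun he => ?_⟩, h2⟩
    rcases Sym2.eq_iff.1 he with ⟨rfl, rfl⟩ | ⟨rfl, rfl⟩
    · exact h ⟨hs h2.1, hs h2.2⟩
    · exact h ⟨hs h2.2, hs h2.1⟩

lemma rich_step {H : SimpleGraph V} {A : Set V} (hA : Rich H A) {v : V} (hv : v ∈ A) {a b : V}
    (h : ¬ (a ∈ A ∧ b ∈ A)) :
    ∃ w, CatMove (H.deleteEdges {s(a, b)}) v w ∧ QQ (H.deleteEdges {s(a, b)}) w := by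
  obtain ⟨hc, T, hT, A', hA', hs⟩ := hA
  have hT' : Fam (H.deleteEdges {s(a, b)}) {X | X ∈ T ∧ X ⊆ A} := by
    rintro X ⟨hX, hXA⟩
    obtain ⟨h1, h2, A0, a0, A1, a1, s0, s1, hd⟩ := hT X hX
    refine ⟨h1, ?_, A0, ⟨a0, s0.trans hXA⟩, A1, ⟨a1, s1.trans hXA⟩, s0, s1, hd⟩
    rw [Conn, RG_del hXA h]
    exact h2
  obtain ⟨w, hw, hvw, hQ⟩ := QQ_of_fam hT' (A := A') ⟨hA', hs⟩ v
  refine ⟨w, ⟨hvw, ?_⟩, hQ⟩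
  have := hc v hv w (hs hw)
  rw [← RG_del subset_rfl h] at this
  exact this.mono (RG_le _)

lemma win_of_QQ {H : SimpleGraph V} {v : V} (h : QQ H v) : CatWinFrom H v := by
  refine ⟨{p | QQ p.1 p.2}, h, ?_⟩
  rintro ⟨P, x⟩ ⟨A0, A1, r0, r1, x0, x1, hx⟩
  dsimp only at r0 r1 x0 x1 hx ⊢
  refine ⟨?_, ?_⟩
  · obtain ⟨hc, T, hT, A', hA', hs⟩ := r0
    obtain ⟨w, hw, hxw, -⟩ := QQ_of_fam hT hA' x
    exact adj_of_reach ((hc x x0 w (hs hw)).mono (RG_le _)) hxw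
  · intro e he
    induction e with
    | h a b =>
      by_cases h0 : a ∈ A0 ∧ b ∈ A0
      · by_cases h1 : a ∈ A1 ∧ b ∈ A1
        · exact absurd ((hx a h0.1 h1.1).trans (hx b h0.2 h1.2).symm) (Adj.ne he)
        · exact rich_step r1 x1 h1
      · exact rich_step r0 x0 h0

end Tree

lemma fam_of_win {V : Type u} {G : SimpleGraph V} (hfin : ∀ v, (KK G v).Finite) :
    Fam G {A | ∃ H, H ≤ G ∧ ∃ v, CatWinFrom H v ∧ A = {w | H.Reachable v w}} := by
  rintro _ ⟨H, hle, v, hw, rfl⟩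
  refine ⟨⟨v, Reachable.rfl⟩, conn_comp hle v, ?_⟩
  have hK : (KK H v).Finite := (hfin v).subset fun w hw => IsEdgeReachable.mono hle hw
  obtain ⟨a, b, hab, hnr, hva, ⟨x, hx, hxw⟩, ⟨y, hy, hyw⟩⟩ := split hw hK
  have hd : H.deleteEdges {s(a, b)} ≤ H := deleteEdges_le _
  refine ⟨_, ⟨_, hd.trans hle, x, hxw, rfl⟩, _, ⟨_, hd.trans hle, y, hyw, rfl⟩, ?_, ?_, ?_⟩
  · exact fun w hw => hva.trans ((hx.trans hw).mono hd)
  · exact fun w hw => hva.trans (hab.reachable.trans ((hy.trans hw).mono hd))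
  · rw [Set.disjoint_left]
    exact fun w h1 h2 => hnr ((hx.trans h1).trans (hy.trans h2).symm)

/-- a graph is cat-win iff it has an infinite complete binary tree
minor or an infinite 2-edge-connected subgraph. -/
theorem catWin_iff {V : Type u} (G : SimpleGraph V) :
    CatWin G ↔ IsMinor binTree G ∨
      ∃ H : G.Subgraph, H.verts.Infinite ∧ TwoEdgeConnected H.coe := by
  constructor
  · rintro ⟨v, hv⟩
    by_cases hfin : ∀ v, (KK G v).Finite
    · exact Or.inl (minor_of_fam (fam_of_win hfin) ⟨_, G, le_rfl, v, hv, rfl⟩)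
    · push Not at hfin
      obtain ⟨w, hw⟩ := hfin
      exact Or.inr (exists_sub_of_KK w hw)
  · rintro (h | ⟨H, h1, h2⟩)
    · obtain ⟨T, hT, A, hA⟩ := fam_of_minor h
      obtain ⟨r, -⟩ := (hT A hA).1
      obtain ⟨w, -, -, hw⟩ := QQ_of_fam hT hA r
      exact ⟨w, win_of_QQ hw⟩
    · obtain ⟨v, hv⟩ := KK_of_sub H h1 h2
      exact ⟨v, win_of_KK hv⟩
end

section
/- Suppose there exists k such that G contains no path on k vertices as a subgraph and no vertex of G lies on k pairwise edge-disjoint cycles. Then cat(G) ≤ k³ − 2k² + 3k − 2. -/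
open SimpleGraph

universe u

namespace CatAux

theorem mono {V : Type u} {G : SimpleGraph V} {v : V} {n : ℕ} (h : CapturedIn G v n) :
    ∀ m, n ≤ m → CapturedIn G v m := by
  induction h with
  | isolated h => intro m _; exact .isolated h
  | cut e he h ih =>
    intro m hm
    obtain ⟨m, rfl⟩ : ∃ m', m = m' + 1 := ⟨m - 1, by omega⟩
    exact .cut e he (fun w hw => ih w hw m (by omega))

theorem bulk {V : Type u} (S : List (Sym2 V)) : ∀ (H : SimpleGraph V) (v : V) (n : ℕ),
    (∀ w, H.Reachable v w → CapturedIn (H.deleteEdges {e | e ∈ S}) w n) →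
    CapturedIn H v (S.length + n) := by
  induction S with
  | nil =>
    intro H v n h
    have := h v (Reachable.refl v)
    simpa using this
  | cons e S ih =>
    intro H v n h
    have hEq : (H.deleteEdges {e}).deleteEdges {x | x ∈ S} =
        H.deleteEdges {x | x ∈ e :: S} := by
      rw [deleteEdges_deleteEdges]; congr 1
      ext x; simp
    by_cases he : e ∈ H.edgeSet
    · have : (e :: S).length + n = (S.length + n) + 1 := by simp; omega
      rw [this]
      refine .cut e he (fun w hw => ih _ w n (fun w' hw' => ?_))
      rw [hEq]
      exact h w' ((hw.2.trans hw').mono (deleteEdges_le _))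
    · have h0 : H.deleteEdges {e} = H := by
        ext a b
        simp only [deleteEdges_adj, Set.mem_singleton_iff]
        constructor
        · exact fun h => h.1
        · exact fun h => ⟨h, fun h2 => he (h2 ▸ h)⟩
      rw [h0] at hEq
      refine mono (ih H v n (fun w hw => ?_)) _ (by simp)
      rw [hEq]; exact h w hw

def NoCyc {V : Type u} (H : SimpleGraph V) (v : V) (m : ℕ) : Prop :=
  ¬ ∃ (c : Fin m → H.Walk v v), (∀ i, (c i).IsCycle) ∧
      ∀ i j, i ≠ j → ∀ e ∈ (c i).edges, e ∉ (c j).edges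

theorem NoCyc.anti {V : Type u} {H H' : SimpleGraph V} {v : V} {m : ℕ} (h : NoCyc H v m)
    (hle : H' ≤ H) : NoCyc H' v m := by
  rintro ⟨c, hc, hd⟩
  refine h ⟨fun i => (c i).mapLe hle, fun i => (hc i).mapLe hle, fun i j hij e he => ?_⟩
  rw [Walk.edges_mapLe_eq_edges] at he ⊢
  exact hd i j hij e he

theorem NoCyc.del {V : Type u} {H : SimpleGraph V} {v : V} {m : ℕ} (h : NoCyc H v (m+1))
    (c : H.Walk v v) (hc : c.IsCycle) : NoCyc (H.deleteEdges {e | e ∈ c.edges}) v m := by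
  rintro ⟨d, hd, hdd⟩
  have hle := deleteEdges_le (G := H) {e | e ∈ c.edges}
  have key : ∀ i, ∀ e ∈ (d i).edges, e ∉ c.edges := by
    intro i e he hec
    have := (d i).edges_subset_edgeSet he
    rw [edgeSet_deleteEdges] at this
    exact this.2 hec
  refine h ⟨Fin.cons c (fun i => (d i).mapLe hle), ?_, ?_⟩
  · intro i
    refine Fin.cases ?_ (fun i => ?_) i
    · simpa using hc
    · simpa using (hd i).mapLe hle
  · intro i j
    refine Fin.cases ?_ (fun i => ?_) i <;> refine Fin.cases ?_ (fun j => ?_) j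
    · simp
    · intro _ e he he2
      simp only [Fin.cons_succ, Fin.cons_zero, Walk.edges_mapLe_eq_edges] at he he2
      exact key j e he2 he
    · intro _ e he he2
      simp only [Fin.cons_succ, Fin.cons_zero, Walk.edges_mapLe_eq_edges] at he he2
      exact key i e he he2
    · intro hij e he he2
      simp only [Fin.cons_succ, Walk.edges_mapLe_eq_edges] at he he2
      exact hdd i j (fun h => hij (by rw [h])) e he he2

theorem bridge {V : Type u} {H : SimpleGraph V} {v x : V}
    (h : ∀ c : H.Walk v v, ¬ c.IsCycle) (ha : H.Adj v x) :
    ¬ (H.deleteEdges {s(v, x)}).Reachable v x := by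
  classical
  intro hr
  obtain ⟨u, p, hp, he⟩ := adj_and_reachable_delete_edges_iff_exists_cycle.1 ⟨ha, hr⟩
  have hv := p.fst_mem_support_of_mem_edges he
  exact h _ (hp.rotate hv)

theorem reachCut {V : Type u} {H : SimpleGraph V} {v w : V}
    (h : ∀ c : H.Walk v v, ¬ c.IsCycle) (hne : w ≠ v) (hr : H.Reachable w v) :
    ∃ e ∈ H.edgeSet, ¬ (H.deleteEdges {e}).Reachable w v := by
  classical
  obtain ⟨p, hp⟩ := hr.symm.exists_isPath
  cases p with
  | nil => exact absurd rfl hne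
  | @cons _ x _ ha q =>
    rw [Walk.cons_isPath_iff] at hp
    refine ⟨s(v, x), ha, fun hwv => bridge h ha ?_⟩
    have : s(v, x) ∉ q.edges := fun hm => hp.2 (q.fst_mem_support_of_mem_edges hm)
    exact (Reachable.trans ⟨q.toDeleteEdge _ this⟩ hwv).symm

theorem stepB {V : Type u} (v : V) (L n : ℕ) (m : ℕ) : ∀ (H : SimpleGraph V) (u : V),
    (∀ c : H.Walk v v, c.IsCycle → c.length ≤ L) → NoCyc H v m →
    (∀ H' ≤ H, ∀ w, H.Reachable u w → ¬ H'.Reachable w v → CapturedIn H' w n) →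
    CapturedIn H u (m * L + 2 + n) := by
  induction m with
  | zero =>
    intro H u _ h
    exact absurd ⟨Fin.elim0, fun i => i.elim0, fun i => i.elim0⟩ h
  | succ m ih =>
    intro H u hL hN hC
    by_cases hcyc : ∃ c : H.Walk v v, c.IsCycle
    · obtain ⟨c, hc⟩ := hcyc
      have hle := deleteEdges_le (G := H) {e | e ∈ c.edges}
      refine mono (bulk c.edges H u (m * L + 2 + n) (fun w hw => ?_)) _ ?_
      · refine ih _ w ?_ (hN.del c hc) ?_
        · intro d hd
          have := hL _ (hd.mapLe hle)
          simpa using this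
        · intro H' hH' w' hw' hn
          exact hC H' (hH'.trans hle) w' (hw.trans (hw'.mono hle)) hn
      · have := hL c hc
        rw [Walk.length_edges]
        nlinarith
    · push Not at hcyc
      have h1 : ∀ H' ≤ H, ∀ w, H.Reachable u w → w ≠ v → CapturedIn H' w (n + 1) := by
        intro H' hle w hw hne
        by_cases hr : H'.Reachable w v
        · have hcyc' : ∀ c : H'.Walk v v, ¬ c.IsCycle := fun c hc => hcyc _ (hc.mapLe hle)
          obtain ⟨e, he, hn⟩ := reachCut hcyc' hne hr
          refine .cut e he (fun w' hw' => ?_)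
          have hle' := deleteEdges_le (G := H') {e}
          exact hC _ (hle'.trans hle) w' (hw.trans (hw'.2.mono (hle'.trans hle)))
            (fun h => hn (hw'.2.trans h))
        · exact mono (hC H' hle w hw hr) _ (by omega)
      by_cases huv : u = v
      · subst huv
        by_cases hiso : ∀ w, ¬ H.Adj u w
        · exact .isolated hiso
        · push Not at hiso
          obtain ⟨x, hx⟩ := hiso
          refine mono (n := (n + 1) + 1) (.cut s(u, x) hx (fun w hw => ?_)) _ (by omega)
          have hle' := deleteEdges_le (G := H) {s(u, x)}
          exact h1 _ hle' w (hw.2.mono hle') hw.1.symm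
      · exact mono (h1 H le_rfl u (Reachable.refl u) huv) _ (by omega)

theorem main {V : Type u} (G : SimpleGraph V) (k : ℕ)
    (hpath : ∀ (a b : V) (p : G.Walk a b), p.IsPath → p.length + 1 < k)
    (hcyc : ∀ v, NoCyc G v k) (n : ℕ) : ∀ (H : SimpleGraph V) (u x a : V) (p : G.Walk x a)
    (S : List V), H ≤ G → p.IsPath → p.support = x :: S → k ≤ p.length + 1 + n →
    (∃ q : G.Walk x u, ∀ s ∈ q.support, s ∉ S) → (∀ s ∈ S, ¬ H.Reachable u s) →
    CapturedIn H u (n * (k * (k - 1) + 2)) := by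
  classical
  induction n with
  | zero =>
    intro H u x a p S _ hp _ hk
    have := hpath _ _ p hp
    omega
  | succ n ih =>
    intro H u x a p S hle hp hS hk hq hsep
    obtain ⟨q, hq⟩ := hq
    have hB := stepB x (k - 1) (n * (k * (k - 1) + 2)) k H u ?_ ((hcyc x).anti hle) ?_
    · exact mono hB _ (by rw [Nat.succ_mul]; omega)
    · intro c hc
      have h1 := hpath _ _ _ (hc.mapLe hle).isPath_tail
      have h2 := Walk.length_tail_add_one (p := c.mapLe hle) (hc.mapLe hle).not_nil
      have h3 : (c.mapLe hle).length = c.length := by simp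
      omega
    · intro H' hH' w hw hn
      obtain ⟨r⟩ := hw
      have hr : ∀ s ∈ r.support, s ∉ S := fun s hs hsS =>
        hsep s hsS ⟨r.takeUntil s hs⟩
      have hq2 : ∀ s ∈ (q.append (r.mapLe hle)).bypass.support, s ∉ S := by
        intro s hs
        have := Walk.support_bypass_subset _ hs
        rw [Walk.mem_support_append_iff] at this
        rcases this with h | h
        · exact hq s h
        · rw [Walk.support_mapLe_eq_support] at h
          exact hr s h
      have hqp := (q.append (r.mapLe hle)).bypass_isPath
      generalize (q.append (r.mapLe hle)).bypass = t at hq2 hqp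
      cases t with
      | nil => exact absurd (Reachable.refl _) hn
      | @cons _ y _ ha t =>
        rw [Walk.cons_isPath_iff] at hqp
        have hyS : ∀ s ∈ t.support, s ∉ x :: S := by
          intro s hs
          simp only [List.mem_cons, not_or]
          exact ⟨fun h => hqp.2 (h ▸ hs), hq2 s (by simp [hs])⟩
        refine ih H' w y a (.cons ha.symm p) (x :: S) (hH'.trans hle) ?_ ?_ ?_ ⟨t, hyS⟩ ?_
        · rw [Walk.cons_isPath_iff, hS]
          exact ⟨hp, hyS y t.start_mem_support⟩
        · simp [hS]
        · simp; omega
        · intro s hs hrs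
          rcases List.mem_cons.1 hs with h | h
          · exact hn (h ▸ hrs)
          · exact hsep s h (Reachable.trans ⟨r⟩ (hrs.mono hH'))

end CatAux

/-- if `G` has no path on `k` vertices and no vertex on `k`
pairwise edge-disjoint cycles, then `cat(G) ≤ k³ − 2k² + 3k − 2`. -/
theorem catNum_le_of_no_long_path_no_many_cycles {V : Type u} (G : SimpleGraph V)
    (k : ℕ)
    (hpath : ∀ (a b : V) (p : G.Walk a b), p.IsPath → p.length + 1 < k)
    (hcyc : ¬ ∃ (v : V) (c : Fin k → G.Walk v v), (∀ i, (c i).IsCycle) ∧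
      ∀ i j, i ≠ j → ∀ e ∈ (c i).edges, e ∉ (c j).edges) :
    catNum G ≤ ((k ^ 3 - 2 * k ^ 2 + 3 * k - 2 : ℕ) : ℕ∞) := by
  refine iSup_le (fun v => ?_)
  have hk := hpath v v .nil .nil
  have h := CatAux.main G k hpath (fun v h => hcyc ⟨v, h⟩) (k - 1) G v v v .nil [] le_rfl .nil
    (by simp) (by simp; omega) ⟨.nil, by simp⟩ (by simp)
  have hle : (k - 1) * (k * (k - 1) + 2) ≤ k ^ 3 - 2 * k ^ 2 + 3 * k - 2 := by
    simp at hk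
    obtain ⟨j, rfl⟩ : ∃ j, k = j + 2 := ⟨k - 2, by omega⟩
    have e1 : j + 2 - 1 = j + 1 := by omega
    have e2 : (j + 2) ^ 3 = 2 * (j + 2) ^ 2 + j * (j + 2) ^ 2 := by ring
    rw [e1, e2, Nat.add_sub_cancel_left]
    apply Nat.le_sub_of_add_le
    nlinarith
  exact sInf_le ⟨_, CatAux.mono h _ hle, rfl⟩
end
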